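/- Under conditions (C1) and (C2), if the weights are the adaptive weights w_k = 1/|θ̂_{MLE,k}| built from the √N-consistent maximum likelihood estimator, and λ_N ≍ log N (i.e., c₁ log N ≤ λ_N ≤ c₂ log N for constants 0 < c₁ ≤ c₂ and all large N), then the two rate conditions of Theorem 2 hold: a_w/√N = λ_N max_{k∈A} w_k / √N → 0 in probability and b_w/√N = λ_N min_{k∉A} w_k / √N → ∞ in probability, as n → ∞. -/

import Mathlib

open Finset Real
open scoped Classical

noncomputable section

variable {E : Type*}

/-- Numeric 0/1 value of a Boolean edge indicator. -/
def bval (b : Bool) : ℝ := if b then 1 else 0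

/-- Ordered pairs `(j1, j2)` of nodes with `j1 < j2` (the dyads). -/
def pairsLT (n : ℕ) : Finset (Fin n × Fin n) := univ.filter fun q => q.1 < q.2

/-- Ordered pairs `(j1, j2)` of nodes with `j1 ≠ j2` (the potential directed edges). -/
def pairsNE (n : ℕ) : Finset (Fin n × Fin n) := univ.filter fun q => q.1 ≠ q.2

/-- The finite set of zero-diagonal binary adjacency matrices on `n` nodes. -/
def nets (n : ℕ) : Finset (Fin n → Fin n → Bool) :=
  univ.filter fun x => ∀ j, x j j = false

/-- The exponent `H_θ(x)` of the directed network model with nodal homophily and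
nodal effects, with parameter `θ = (θ1, θ2, γ, ζ, η)`. -/
def Hexp (n m : ℕ) (v : Fin n → Fin m → E) (w : E → E → ℝ) (g : E → ℝ)
    (θ1 θ2 : ℝ) (γ ζ η : Fin m → ℝ) (x : Fin n → Fin n → Bool) : ℝ :=
  θ1 * ∑ q ∈ pairsLT n, bval (x q.1 q.2) * bval (x q.2 q.1)
    + θ2 * ∑ q ∈ pairsNE n, bval (x q.1 q.2)
    + ∑ k, γ k * ∑ q ∈ pairsNE n, bval (x q.1 q.2) * w (v q.1 k) (v q.2 k)
    + ∑ k, ζ k * ∑ q ∈ pairsNE n, bval (x q.1 q.2) * g (v q.1 k)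
    + ∑ k, η k * ∑ q ∈ pairsNE n, bval (x q.1 q.2) * g (v q.2 k)

/-- The dyad weight `T_{ab}(j1, j2)`; note `T_{00}(j1,j2) = 1`. -/
def Tdyad (n m : ℕ) (v : Fin n → Fin m → E) (w : E → E → ℝ) (g : E → ℝ)
    (θ1 θ2 : ℝ) (γ ζ η : Fin m → ℝ) (j1 j2 : Fin n) (a b : Bool) : ℝ :=
  Real.exp (θ1 * (bval a * bval b)
    + (bval a + bval b) * (θ2 + ∑ k, γ k * w (v j1 k) (v j2 k))
    + ∑ k, ζ k * (bval a * g (v j1 k) + bval b * g (v j2 k))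
    + ∑ k, η k * (bval a * g (v j2 k) + bval b * g (v j1 k)))

/-- The normalizing constant `z(θ)` of the directed network model. -/
def zconst (n m : ℕ) (v : Fin n → Fin m → E) (w : E → E → ℝ) (g : E → ℝ)
    (θ1 θ2 : ℝ) (γ ζ η : Fin m → ℝ) : ℝ :=
  ∑ x ∈ nets n, Real.exp (Hexp n m v w g θ1 θ2 γ ζ η x)

/-- The probability mass function `P_θ(X = x) = exp H_θ(x) / z(θ)`. -/
def Pnet (n m : ℕ) (v : Fin n → Fin m → E) (w : E → E → ℝ) (g : E → ℝ)
    (θ1 θ2 : ℝ) (γ ζ η : Fin m → ℝ) (x : Fin n → Fin n → Bool) : ℝ :=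
  Real.exp (Hexp n m v w g θ1 θ2 γ ζ η x) / zconst n m v w g θ1 θ2 γ ζ η

/-- The marginal probability `P_θ(X_{j1j2} = a, X_{j2j1} = b)` of a dyad. -/
def Pdyad (n m : ℕ) (v : Fin n → Fin m → E) (w : E → E → ℝ) (g : E → ℝ)
    (θ1 θ2 : ℝ) (γ ζ η : Fin m → ℝ) (j1 j2 : Fin n) (a b : Bool) : ℝ :=
  ∑ x ∈ (nets n).filter (fun x => x j1 j2 = a ∧ x j2 j1 = b),
    Pnet n m v w g θ1 θ2 γ ζ η x

/-- The marginal probability `P_θ(X_{j1j2} = a)` of a single directed edge indicator. -/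
def Pedge (n m : ℕ) (v : Fin n → Fin m → E) (w : E → E → ℝ) (g : E → ℝ)
    (θ1 θ2 : ℝ) (γ ζ η : Fin m → ℝ) (j1 j2 : Fin n) (a : Bool) : ℝ :=
  ∑ x ∈ (nets n).filter (fun x => x j1 j2 = a), Pnet n m v w g θ1 θ2 γ ζ η x

/-- Index type for the parameter space `ℝ^p` with `p = 3m + 2`: two global parameters
`(θ1, θ2)`, the homophily block, the out-edge block and the in-edge block. -/
abbrev Idx (m : ℕ) := Fin 2 ⊕ (Fin m ⊕ (Fin m ⊕ Fin m))

/-- The vector of sufficient statistics `s(x) ∈ ℝ^p`: the coefficient of each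
coordinate of `θ` in `H_θ(x)`. -/
def svec (n m : ℕ) (v : Fin n → Fin m → E) (w : E → E → ℝ) (g : E → ℝ)
    (x : Fin n → Fin n → Bool) : Idx m → ℝ
  | Sum.inl i =>
      if i = 0 then ∑ q ∈ pairsLT n, bval (x q.1 q.2) * bval (x q.2 q.1)
      else ∑ q ∈ pairsNE n, bval (x q.1 q.2)
  | Sum.inr (Sum.inl k) => ∑ q ∈ pairsNE n, bval (x q.1 q.2) * w (v q.1 k) (v q.2 k)
  | Sum.inr (Sum.inr (Sum.inl k)) => ∑ q ∈ pairsNE n, bval (x q.1 q.2) * g (v q.1 k)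
  | Sum.inr (Sum.inr (Sum.inr k)) => ∑ q ∈ pairsNE n, bval (x q.1 q.2) * g (v q.2 k)

/-- The exponent of the model written as `H_θ(x) = θᵀ s(x)`. -/
def Hvec (n m : ℕ) (v : Fin n → Fin m → E) (w : E → E → ℝ) (g : E → ℝ)
    (θ : Idx m → ℝ) (x : Fin n → Fin n → Bool) : ℝ :=
  ∑ i, θ i * svec n m v w g x i

/-- The normalizing constant (partition function) `z(θ)`. -/
def Zvec (n m : ℕ) (v : Fin n → Fin m → E) (w : E → E → ℝ) (g : E → ℝ)
    (θ : Idx m → ℝ) : ℝ :=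
  ∑ x ∈ nets n, Real.exp (Hvec n m v w g θ x)

/-- The probability mass function `P_θ(X = x) = exp H_θ(x)/z(θ)`. -/
def Pvec (n m : ℕ) (v : Fin n → Fin m → E) (w : E → E → ℝ) (g : E → ℝ)
    (θ : Idx m → ℝ) (x : Fin n → Fin n → Bool) : ℝ :=
  Real.exp (Hvec n m v w g θ x) / Zvec n m v w g θ

/-- Expectation of a real statistic under `P_θ`. -/
def Emean (n m : ℕ) (v : Fin n → Fin m → E) (w : E → E → ℝ) (g : E → ℝ)
    (θ : Idx m → ℝ) (f : (Fin n → Fin n → Bool) → ℝ) : ℝ :=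
  ∑ x ∈ nets n, f x * Pvec n m v w g θ x

/-- The number of dyads `N = n(n−1)/2`. -/
def Ndyads (n : ℕ) : ℕ := n * (n - 1) / 2

/-- The Euclidean norm on `ℝ^p`. -/
def enorm {m : ℕ} (u : Idx m → ℝ) : ℝ := Real.sqrt (∑ i, u i ^ 2)

/-- The log-likelihood `L_N(θ) = H_θ(x) − log z(θ)` at the observed network `x`. -/
def Llik (n m : ℕ) (v : Fin n → Fin m → E) (w : E → E → ℝ) (g : E → ℝ)
    (θ : Idx m → ℝ) (x : Fin n → Fin n → Bool) : ℝ :=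
  Hvec n m v w g θ x - Real.log (Zvec n m v w g θ)

/-- Probability, under `P_{θ0}`, of the event `φ` (a set of zero-diagonal networks). -/
def Pr (n m : ℕ) (v : Fin n → Fin m → E) (w : E → E → ℝ) (g : E → ℝ)
    (θ0 : Idx m → ℝ) (φ : (Fin n → Fin n → Bool) → Prop) : ℝ :=
  ∑ x ∈ (nets n).filter (fun x => φ x), Pvec n m v w g θ0 x

/-- The Fisher information matrix `I_N(θ0) = Cov_{θ0}(∇_θ L_N(θ0))`.  Since the score
is `∇_θ L_N(θ0) = s(X) − E_{θ0}[s(X)]`, this is the covariance matrix of the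
sufficient statistic `s(X)` under `P_{θ0}`. -/
def Ifish (n m : ℕ) (v : Fin n → Fin m → E) (w : E → E → ℝ) (g : E → ℝ)
    (θ0 : Idx m → ℝ) : Matrix (Idx m) (Idx m) ℝ :=
  Matrix.of fun k l =>
    Emean n m v w g θ0 (fun x => svec n m v w g x k * svec n m v w g x l)
      - Emean n m v w g θ0 (fun x => svec n m v w g x k)
          * Emean n m v w g θ0 (fun x => svec n m v w g x l)

/-- Condition (C1): the dyad covariate vectors `S_{j1j2}` (whose entries are `1`, `2`,
`w(v_{j1k}, v_{j2k})`, `g(v_{j1k})` and `g(v_{j2k})`) are uniformly bounded over `n`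
and over dyads, and `θ0` lies in the interior of a compact convex set `Θ ⊂ ℝ^p`. -/
def CondC1 {E : Type*} (m : ℕ) (v : (n : ℕ) → Fin n → Fin m → E)
    (w : E → E → ℝ) (g : E → ℝ) (θ0 : Idx m → ℝ) (Θ : Set (Idx m → ℝ)) : Prop :=
  (∃ B : ℝ, ∀ (n : ℕ) (j1 j2 : Fin n) (k : Fin m),
      |w (v n j1 k) (v n j2 k)| ≤ B ∧ |g (v n j1 k)| ≤ B)
    ∧ IsCompact Θ ∧ Convex ℝ Θ ∧ θ0 ∈ interior Θ

/-- Condition (C2): `N⁻¹ I_N(θ0)` converges, as `n → ∞`, to a positive definite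
matrix `I(θ0)`. -/
def CondC2 {E : Type*} (m : ℕ) (v : (n : ℕ) → Fin n → Fin m → E)
    (w : E → E → ℝ) (g : E → ℝ) (θ0 : Idx m → ℝ)
    (Imat : Matrix (Idx m) (Idx m) ℝ) : Prop :=
  Filter.Tendsto (fun n : ℕ => ((Ndyads n : ℝ))⁻¹ • Ifish n m (v n) w g θ0)
      Filter.atTop (nhds Imat)
    ∧ Imat.PosDef

section Product

variable {ι Y : Type*}

/-- Expectation of `f` under the weights `p` on a finite type. -/
def wmean [Fintype Y] (p f : Y → ℝ) : ℝ := ∑ y, p y * f y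

/-- Variance of `f` under the weights `p` on a finite type. -/
def wvar [Fintype Y] (p f : Y → ℝ) : ℝ := wmean p (fun y => f y ^ 2) - wmean p f ^ 2

theorem wvar_eq_centered [Fintype Y] {p : Y → ℝ} (hp1 : ∑ y, p y = 1) (f : Y → ℝ) :
    wvar p f = wmean p (fun y => (f y - wmean p f) ^ 2) := by
  have h : wmean p (fun y => (f y - wmean p f) ^ 2)
      = ∑ y, p y * f y ^ 2 - 2 * wmean p f * ∑ y, p y * f y + wmean p f ^ 2 * ∑ y, p y := by
    rw [mul_sum, mul_sum, ← sum_sub_distrib, ← sum_add_distrib]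
    exact sum_congr rfl fun y _ => by ring
  rw [h, hp1, wvar]
  simp only [wmean]
  ring

theorem abs_wmean_le [Fintype Y] {p : Y → ℝ} (hp : ∀ y, 0 ≤ p y) (hp1 : ∑ y, p y = 1)
    {f : Y → ℝ} {b : ℝ} (hf : ∀ y, |f y| ≤ b) : |wmean p f| ≤ b := by
  calc |wmean p f| ≤ ∑ y, |p y * f y| := abs_sum_le_sum_abs _ _
    _ ≤ ∑ y, p y * b := sum_le_sum fun y _ => by
        rw [abs_mul, abs_of_nonneg (hp y)]
        exact mul_le_mul_of_nonneg_left (hf y) (hp y)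
    _ = b := by rw [← sum_mul, hp1, one_mul]

/-- Second-order expansion of the cumulant generating function of a bounded variable. -/
theorem abs_log_wmean_exp_sub_le [Fintype Y] {p : Y → ℝ} (hp : ∀ y, 0 ≤ p y)
    (hp1 : ∑ y, p y = 1) {f : Y → ℝ} {b : ℝ} (hb0 : 0 ≤ b) (hb : b ≤ 1 / 4)
    (hf : ∀ y, |f y| ≤ b) :
    |log (wmean p fun y => exp (f y)) - wmean p f - wvar p f / 2| ≤ 10 * b ^ 3 := by
  set μ := wmean p f with hμ
  have hμb : |μ| ≤ b := abs_wmean_le hp hp1 hf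
  have hg : ∀ y, |f y - μ| ≤ 2 * b := fun y => by
    have := abs_sub (f y) μ
    have := hf y
    linarith
  have hvar : wvar p f = ∑ y, p y * (f y - μ) ^ 2 := wvar_eq_centered hp1 f
  set z := (wmean p fun y => exp (f y - μ)) - 1 with hz
  have hfac : (wmean p fun y => exp (f y)) = exp μ * (1 + z) := by
    rw [hz, add_sub_cancel]
    simp only [wmean]
    rw [mul_sum]
    refine sum_congr rfl fun y _ => ?_
    rw [exp_sub]
    field_simp
  have hcent : ∑ y, p y * (f y - μ) = 0 := by
    simp only [mul_sub, sum_sub_distrib]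
    rw [← sum_mul, hp1, hμ, wmean]
    ring
  have hdiff : z - wvar p f / 2
      = wmean p fun y => exp (f y - μ) - (1 + (f y - μ) + (f y - μ) ^ 2 / 2) := by
    rw [hz, hvar]
    simp only [wmean, mul_sub, mul_add, sum_sub_distrib, sum_add_distrib, mul_one, hp1]
    simp only [mul_sub, sum_sub_distrib] at hcent
    rw [hcent, sum_div]
    simp only [mul_div_assoc]
    ring
  have hb3 : |z - wvar p f / 2| ≤ 2 * b ^ 3 := by
    rw [hdiff]
    refine abs_wmean_le hp hp1 fun y => ?_
    have h1 : |f y - μ| ≤ 1 := (hg y).trans (by linarith)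
    have h2 := Real.exp_bound h1 (n := 3) (by norm_num)
    simp only [sum_range_succ, range_zero, sum_empty, Nat.factorial] at h2
    norm_num at h2
    have h3 : |f y - μ| ^ 3 ≤ (2 * b) ^ 3 := pow_le_pow_left₀ (abs_nonneg _) (hg y) 3
    have h4 : 0 ≤ b ^ 3 := by positivity
    calc _ ≤ |f y - μ| ^ 3 * (2 / 9) := h2
      _ ≤ 2 * b ^ 3 := by nlinarith
  have hv0 : 0 ≤ wvar p f := by
    rw [hvar]
    exact sum_nonneg fun y _ => mul_nonneg (hp y) (sq_nonneg _)
  have hv1 : wvar p f ≤ 4 * b ^ 2 := by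
    have : |wvar p f| ≤ 4 * b ^ 2 := by
      rw [wvar_eq_centered hp1]
      refine abs_wmean_le hp hp1 fun y => ?_
      rw [abs_pow]
      calc |f y - μ| ^ 2 ≤ (2 * b) ^ 2 := pow_le_pow_left₀ (abs_nonneg _) (hg y) 2
        _ = 4 * b ^ 2 := by ring
    exact (le_abs_self _).trans this
  have hzb : |z| ≤ 4 * b ^ 2 := by
    have h5 := abs_le.1 hb3
    have h6 : b ^ 3 ≤ b ^ 2 * (1 / 4) := by
      rw [pow_succ]
      exact mul_le_mul_of_nonneg_left hb (by positivity)
    exact abs_le.2 ⟨by nlinarith, by nlinarith⟩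
  have hz4 : |z| ≤ 1 / 4 := by nlinarith
  have hlog : |log (1 + z) - z| ≤ 8 * b ^ 3 := by
    have h7 := Real.abs_log_sub_add_sum_range_le (x := -z) (by rw [abs_neg]; linarith) 1
    simp only [sum_range_succ, range_zero, sum_empty, abs_neg, sub_neg_eq_add] at h7
    norm_num at h7
    have h8 : z ^ 2 / (1 - |z|) ≤ 8 * b ^ 3 := by
      rw [div_le_iff₀ (by linarith)]
      have h9 : z ^ 2 ≤ (4 * b ^ 2) ^ 2 := by
        rw [← sq_abs z]
        exact pow_le_pow_left₀ (abs_nonneg _) hzb 2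
      have h10 : b ^ 4 ≤ b ^ 3 * (1 / 4) := by
        rw [pow_succ b 3]
        exact mul_le_mul_of_nonneg_left hb (by positivity)
      have h11 : 0 ≤ b ^ 3 := by positivity
      nlinarith
    calc |log (1 + z) - z| = |-z + log (1 + z)| := by congr 1; ring
      _ ≤ _ := h7
      _ ≤ _ := h8
  have hz1 : 0 < 1 + z := by
    have := abs_le.1 hz4
    linarith
  rw [hfac, log_mul (exp_pos _).ne' hz1.ne', log_exp]
  have h12 := abs_le.1 hlog
  have h13 := abs_le.1 hb3
  exact abs_le.2 ⟨by linarith, by linarith⟩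

/-- A bounded variable has a characteristic function of modulus at most `exp (-Var / 8)`. -/
theorem norm_charFun_le [Fintype Y] {p : Y → ℝ} (hp : ∀ y, 0 ≤ p y)
    (hp1 : ∑ y, p y = 1) {f : Y → ℝ} (hf : ∀ y, |f y| ≤ 1) :
    ‖∑ y, (p y : ℂ) * Complex.exp (f y * Complex.I)‖ ≤ exp (-wvar p f / 8) := by
  have hre : (∑ y, (p y : ℂ) * Complex.exp (f y * Complex.I)).re = ∑ y, p y * cos (f y) := by
    rw [Complex.re_sum]
    refine sum_congr rfl fun y _ => ?_
    rw [Complex.re_ofReal_mul, Complex.exp_ofReal_mul_I_re]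
  have him : (∑ y, (p y : ℂ) * Complex.exp (f y * Complex.I)).im = ∑ y, p y * sin (f y) := by
    rw [Complex.im_sum]
    refine sum_congr rfl fun y _ => ?_
    rw [Complex.im_ofReal_mul, Complex.exp_ofReal_mul_I_im]
  have hsq : ‖∑ y, (p y : ℂ) * Complex.exp (f y * Complex.I)‖ ^ 2
      = ∑ y, ∑ y', p y * p y' * cos (f y - f y') := by
    rw [← Complex.normSq_eq_norm_sq, Complex.normSq_apply, hre, him, sum_mul_sum, sum_mul_sum,
      ← sum_add_distrib]
    refine sum_congr rfl fun y _ => ?_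
    rw [← sum_add_distrib]
    refine sum_congr rfl fun y' _ => ?_
    rw [cos_sub]
    ring
  have hcos : ∀ y y', cos (f y - f y') ≤ 1 - 1 / 8 * (f y - f y') ^ 2 := fun y y' => by
    have h1 : |f y - f y'| ≤ 2 := by
      have := abs_sub (f y) (f y')
      have := hf y
      have := hf y'
      linarith
    have h2 := Real.cos_le_one_sub_mul_cos_sq (h1.trans two_le_pi)
    have h3 : (1 : ℝ) / 8 ≤ 2 / π ^ 2 := by
      rw [div_le_div_iff₀ (by norm_num) (by positivity)]
      nlinarith [pi_le_four, pi_pos]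
    nlinarith [sq_nonneg (f y - f y')]
  have hle : ‖∑ y, (p y : ℂ) * Complex.exp (f y * Complex.I)‖ ^ 2 ≤ 1 - wvar p f / 4 := by
    rw [hsq]
    calc _ ≤ ∑ y, ∑ y', p y * p y' * (1 - 1 / 8 * (f y - f y') ^ 2) :=
          sum_le_sum fun y _ => sum_le_sum fun y' _ =>
            mul_le_mul_of_nonneg_left (hcos y y') (mul_nonneg (hp y) (hp y'))
      _ = (∑ y, p y) * (∑ y, p y) - 1 / 8 * ((∑ y, p y * f y ^ 2) * ∑ y, p y)
          + 1 / 4 * ((∑ y, p y * f y) * ∑ y, p y * f y)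
          - 1 / 8 * ((∑ y, p y) * ∑ y, p y * f y ^ 2) := by
        simp only [sum_mul_sum]
        simp only [mul_sum, ← sum_add_distrib, ← sum_sub_distrib]
        exact sum_congr rfl fun y _ => sum_congr rfl fun y' _ => by ring
      _ = 1 - wvar p f / 4 := by
        rw [hp1]
        simp only [wvar, wmean]
        ring
  refine (sq_le_sq₀ (norm_nonneg _) (exp_pos _).le).1 ?_
  calc _ ≤ 1 - wvar p f / 4 := hle
    _ ≤ exp (-wvar p f / 4) := by
      have := add_one_le_exp (-wvar p f / 4)
      linarith
    _ = exp (-wvar p f / 8) ^ 2 := by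
      rw [← exp_nat_mul]
      congr 1
      push_cast
      ring

theorem sum_prod_mul_prod [Fintype ι] [DecidableEq ι] [Fintype Y] {R : Type*} [CommSemiring R]
    (p f : ι → Y → R) :
    ∑ ω : ι → Y, (∏ q, p q (ω q)) * ∏ q, f q (ω q) = ∏ q, ∑ y, p q y * f q y := by
  rw [prod_univ_sum, Fintype.piFinset_univ]
  exact sum_congr rfl fun ω _ => prod_mul_distrib.symm

theorem sum_prod_mul_apply [Fintype ι] [DecidableEq ι] [Fintype Y] {p : ι → Y → ℝ}
    (hp1 : ∀ q, ∑ y, p q y = 1) (r : ι) (f : Y → ℝ) :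
    ∑ ω : ι → Y, (∏ q, p q (ω q)) * f (ω r) = wmean (p r) f := by
  have h := sum_prod_mul_prod p (fun q y => if q = r then f y else 1)
  simp only [prod_ite_eq', mem_univ, if_true] at h
  rw [h, prod_eq_single r]
  · simp [wmean]
  · intro q _ hq
    simp [hq, hp1]
  · simp

theorem sum_prod_mul_apply_mul_apply [Fintype ι] [DecidableEq ι] [Fintype Y] {p : ι → Y → ℝ}
    (hp1 : ∀ q, ∑ y, p q y = 1) {r s : ι} (hrs : r ≠ s) (f g : Y → ℝ) :
    ∑ ω : ι → Y, (∏ q, p q (ω q)) * (f (ω r) * g (ω s)) = wmean (p r) f * wmean (p s) g := by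
  have h := sum_prod_mul_prod p
    (fun q y => (if q = r then f y else 1) * (if q = s then g y else 1))
  simp only [prod_mul_distrib, prod_ite_eq', mem_univ, if_true] at h
  rw [h, ← mul_prod_erase univ _ (mem_univ r),
    ← mul_prod_erase (univ.erase r) _ (mem_erase.2 ⟨hrs.symm, mem_univ s⟩), prod_eq_one]
  · simp [wmean, hrs, hrs.symm]
  · intro q hq
    simp only [mem_erase, mem_univ, and_true] at hq
    simp [hq.1, hq.2, hp1]

theorem sum_prod_mul_sum [Fintype ι] [DecidableEq ι] [Fintype Y] {p : ι → Y → ℝ}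
    (hp1 : ∀ q, ∑ y, p q y = 1) (f : ι → Y → ℝ) :
    ∑ ω : ι → Y, (∏ q, p q (ω q)) * ∑ q, f q (ω q) = ∑ q, wmean (p q) (f q) := by
  simp only [mul_sum]
  rw [sum_comm]
  exact sum_congr rfl fun q _ => sum_prod_mul_apply hp1 q (f q)

theorem sum_prod_mul_sum_sq [Fintype ι] [DecidableEq ι] [Fintype Y] {p : ι → Y → ℝ}
    (hp1 : ∀ q, ∑ y, p q y = 1) (f : ι → Y → ℝ) :
    ∑ ω : ι → Y, (∏ q, p q (ω q)) * (∑ q, f q (ω q)) ^ 2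
      = (∑ q, wmean (p q) (f q)) ^ 2 + ∑ q, wvar (p q) (f q) := by
  have h : ∀ r s, ∑ ω : ι → Y, (∏ q, p q (ω q)) * (f r (ω r) * f s (ω s))
      = wmean (p r) (f r) * wmean (p s) (f s) + if r = s then wvar (p r) (f r) else 0 := by
    intro r s
    by_cases hrs : r = s
    · subst hrs
      have := sum_prod_mul_apply hp1 r (fun y => f r y * f r y)
      simp only [this, if_true, wvar, sq]
      ring
    · rw [if_neg hrs, add_zero, sum_prod_mul_apply_mul_apply hp1 hrs]
  simp only [sq, sum_mul_sum]
  simp only [mul_sum]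
  rw [sum_comm]
  have h' : ∀ r, ∑ ω : ι → Y, ∑ s, (∏ q, p q (ω q)) * (f r (ω r) * f s (ω s))
      = ∑ s, wmean (p r) (f r) * wmean (p s) (f s) + wvar (p r) (f r) := fun r => by
    rw [sum_comm, sum_congr rfl fun s _ => h r s, sum_add_distrib]
    simp
  rw [sum_congr rfl fun r _ => h' r, sum_add_distrib]

/-- Cosine moments of a sum of independent bounded variables, about any centre. -/
theorem abs_sum_prod_mul_cos_le [Fintype ι] [DecidableEq ι] [Fintype Y] {p : ι → Y → ℝ}
    (hp : ∀ q y, 0 ≤ p q y) (hp1 : ∀ q, ∑ y, p q y = 1) {f : ι → Y → ℝ}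
    (hf : ∀ q y, |f q y| ≤ 1) (c : ℝ) :
    |∑ ω : ι → Y, (∏ q, p q (ω q)) * cos (∑ q, f q (ω q) - c)|
      ≤ exp (-(∑ q, wvar (p q) (f q)) / 8) := by
  set S : ℂ := ∑ ω : ι → Y, (∏ q, (p q (ω q) : ℂ)) * ∏ q, Complex.exp (f q (ω q) * Complex.I)
  have hS : ‖S‖ ≤ exp (-(∑ q, wvar (p q) (f q)) / 8) := by
    have hfac : S = ∏ q, ∑ y, (p q y : ℂ) * Complex.exp (f q y * Complex.I) :=
      sum_prod_mul_prod (fun q y => (p q y : ℂ)) fun q y => Complex.exp (f q y * Complex.I)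
    rw [hfac, norm_prod, ← sum_neg_distrib, sum_div, exp_sum]
    exact prod_le_prod (fun q _ => norm_nonneg _) fun q _ => norm_charFun_le (hp q) (hp1 q) (hf q)
  have hre : ∑ ω : ι → Y, (∏ q, p q (ω q)) * cos (∑ q, f q (ω q) - c)
      = (S * Complex.exp ((-c : ℝ) * Complex.I)).re := by
    rw [sum_mul, Complex.re_sum]
    refine sum_congr rfl fun ω _ => ?_
    rw [← Complex.exp_sum, ← sum_mul, mul_assoc, ← Complex.exp_add, ← Complex.ofReal_prod,
      Complex.re_ofReal_mul, ← Complex.ofReal_sum, ← add_mul, ← Complex.ofReal_add,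
      Complex.exp_ofReal_mul_I_re, sub_eq_add_neg]
  rw [hre]
  refine (Complex.abs_re_le_norm _).trans ?_
  rw [norm_mul, Complex.norm_exp_ofReal_mul_I, mul_one]
  exact hS

end Product
section Dyads

variable {n m : ℕ}

/-- Contribution of the dyad `q`, in state `y`, to the sufficient statistic. -/
def dyadStat (v : Fin n → Fin m → E) (w : E → E → ℝ) (g : E → ℝ)
    (q : Fin n × Fin n) (y : Bool × Bool) : Idx m → ℝ
  | Sum.inl i => if i = 0 then bval y.1 * bval y.2 else bval y.1 + bval y.2
  | Sum.inr (Sum.inl k) =>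
      bval y.1 * w (v q.1 k) (v q.2 k) + bval y.2 * w (v q.2 k) (v q.1 k)
  | Sum.inr (Sum.inr (Sum.inl k)) => bval y.1 * g (v q.1 k) + bval y.2 * g (v q.2 k)
  | Sum.inr (Sum.inr (Sum.inr k)) => bval y.1 * g (v q.2 k) + bval y.2 * g (v q.1 k)

/-- Exponent of the dyad `q` in state `y`. -/
def dyadExp (v : Fin n → Fin m → E) (w : E → E → ℝ) (g : E → ℝ) (θ : Idx m → ℝ)
    (q : Fin n × Fin n) (y : Bool × Bool) : ℝ :=
  ∑ i, θ i * dyadStat v w g q y i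

/-- Normalizing constant of the dyad `q`. -/
def dyadZ (v : Fin n → Fin m → E) (w : E → E → ℝ) (g : E → ℝ) (θ : Idx m → ℝ)
    (q : Fin n × Fin n) : ℝ :=
  ∑ y, exp (dyadExp v w g θ q y)

/-- Distribution of the dyad `q`. -/
def dyadProb (v : Fin n → Fin m → E) (w : E → E → ℝ) (g : E → ℝ) (θ : Idx m → ℝ)
    (q : Fin n × Fin n) (y : Bool × Bool) : ℝ :=
  exp (dyadExp v w g θ q y) / dyadZ v w g θ q

/-- The network whose dyads are in the given states. -/
def toNet (ω : {q // q ∈ pairsLT n} → Bool × Bool) (j1 j2 : Fin n) : Bool :=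
  if h : j1 < j2 then (ω ⟨(j1, j2), by simpa [pairsLT] using h⟩).1
  else if h : j2 < j1 then (ω ⟨(j2, j1), by simpa [pairsLT] using h⟩).2
  else false

theorem sum_pairsNE (f : Fin n × Fin n → ℝ) :
    ∑ q ∈ pairsNE n, f q = ∑ q ∈ pairsLT n, (f q + f q.swap) := by
  have h : pairsNE n = pairsLT n ∪ (pairsLT n).image Prod.swap := by
    ext ⟨a, b⟩
    simp only [pairsNE, pairsLT, mem_union, mem_filter, mem_univ, true_and, mem_image,
      Prod.exists, Prod.swap_prod_mk, Prod.mk.injEq]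
    constructor
    · intro hab
      rcases lt_or_gt_of_ne hab with h | h
      · exact Or.inl h
      · exact Or.inr ⟨b, a, h, rfl, rfl⟩
    · rintro (h | ⟨a', b', h, rfl, rfl⟩)
      · exact h.ne
      · exact h.ne'
  rw [h, sum_union, sum_image Prod.swap_injective.injOn, sum_add_distrib]
  rw [disjoint_left]
  rintro ⟨a, b⟩ h1 h2
  simp only [pairsLT, mem_filter, mem_univ, true_and, mem_image, Prod.exists,
    Prod.swap_prod_mk, Prod.mk.injEq] at h1 h2
  obtain ⟨a', b', h, rfl, rfl⟩ := h2
  exact lt_asymm h h1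

theorem card_pairsLT : (pairsLT n).card = Ndyads n := by
  have h1 := sum_pairsNE (n := n) fun _ => 1
  have h2 : pairsNE n = (univ : Finset (Fin n)).offDiag := by
    ext q
    simp [pairsNE, mem_offDiag]
  have h3 : (pairsNE n).card = 2 * (pairsLT n).card := by
    simp only [sum_const, nsmul_eq_mul, mul_one] at h1
    exact_mod_cast (by linarith : ((pairsNE n).card : ℝ) = 2 * (pairsLT n).card)
  rw [h2, offDiag_card, card_univ, Fintype.card_fin] at h3
  rw [Ndyads, Nat.mul_sub_one]
  omega

theorem svec_eq_sum (v : Fin n → Fin m → E) (w : E → E → ℝ) (g : E → ℝ)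
    (x : Fin n → Fin n → Bool) (i : Idx m) :
    svec n m v w g x i
      = ∑ q ∈ pairsLT n, dyadStat v w g q (x q.1 q.2, x q.2 q.1) i := by
  rcases i with i | k | k | k
  · by_cases hi : i = 0
    · simp [svec, dyadStat, hi]
    · simp [svec, dyadStat, hi, sum_pairsNE]
  · simp [svec, dyadStat, sum_pairsNE]
  · simp [svec, dyadStat, sum_pairsNE]
  · simp [svec, dyadStat, sum_pairsNE]

theorem toNet_dyad (ω : {q // q ∈ pairsLT n} → Bool × Bool) (q : {q // q ∈ pairsLT n}) :
    (toNet ω q.1.1 q.1.2, toNet ω q.1.2 q.1.1) = ω q := by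
  obtain ⟨⟨a, b⟩, h⟩ := q
  have hab : a < b := by simpa [pairsLT] using h
  simp [toNet, hab, hab.not_gt]

theorem sum_nets {R : Type*} [AddCommMonoid R] (F : (Fin n → Fin n → Bool) → R) :
    ∑ x ∈ nets n, F x = ∑ ω : {q // q ∈ pairsLT n} → Bool × Bool, F (toNet ω) := by
  have hinv : ∀ x ∈ nets n,
      toNet (fun q : {q // q ∈ pairsLT n} => (x q.1.1 q.1.2, x q.1.2 q.1.1)) = x := by
    intro x hx
    ext a b
    rcases lt_trichotomy a b with h | h | h
    · simp [toNet, h]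
    · subst h
      have : x a a = false := by simpa [nets] using (mem_filter.1 hx).2 a
      simp [toNet, this]
    · simp [toNet, h, h.not_gt]
  refine sum_nbij' (fun x q => (x q.1.1 q.1.2, x q.1.2 q.1.1)) toNet
    (fun _ _ => mem_univ _) (fun ω _ => ?_) hinv (fun ω _ => ?_) fun x hx => by rw [hinv x hx]
  · simp [nets, toNet]
  · exact funext fun q => toNet_dyad ω q

variable (v : Fin n → Fin m → E) (w : E → E → ℝ) (g : E → ℝ) (θ : Idx m → ℝ)

theorem Hvec_toNet (ω : {q // q ∈ pairsLT n} → Bool × Bool) :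
    Hvec n m v w g θ (toNet ω) = ∑ q, dyadExp v w g θ q.1 (ω q) := by
  simp only [Hvec, dyadExp]
  rw [sum_comm]
  refine sum_congr rfl fun i _ => ?_
  rw [svec_eq_sum, ← sum_coe_sort (pairsLT n), mul_sum]
  exact sum_congr rfl fun q _ => by rw [toNet_dyad]

theorem dyadZ_pos (q : Fin n × Fin n) : 0 < dyadZ v w g θ q :=
  sum_pos (fun _ _ => exp_pos _) univ_nonempty

theorem dyadProb_nonneg (q : Fin n × Fin n) (y : Bool × Bool) : 0 ≤ dyadProb v w g θ q y :=
  div_nonneg (exp_pos _).le (dyadZ_pos v w g θ q).le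

theorem sum_dyadProb (q : Fin n × Fin n) : ∑ y, dyadProb v w g θ q y = 1 := by
  simp only [dyadProb, ← sum_div]
  exact div_self (dyadZ_pos v w g θ q).ne'

theorem Zvec_eq_prod :
    Zvec n m v w g θ = ∏ q : {q // q ∈ pairsLT n}, dyadZ v w g θ q.1 := by
  have h := sum_prod_mul_prod (fun (_ : {q // q ∈ pairsLT n}) (_ : Bool × Bool) => (1 : ℝ))
    fun q y => exp (dyadExp v w g θ q.1 y)
  simp only [prod_const_one, one_mul] at h
  simp only [dyadZ]
  rw [Zvec, sum_nets, ← h]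
  exact sum_congr rfl fun ω _ => by rw [Hvec_toNet, exp_sum]

theorem Zvec_pos : 0 < Zvec n m v w g θ := by
  rw [Zvec_eq_prod]
  exact prod_pos fun q _ => dyadZ_pos v w g θ q.1

theorem Pvec_toNet (ω : {q // q ∈ pairsLT n} → Bool × Bool) :
    Pvec n m v w g θ (toNet ω) = ∏ q, dyadProb v w g θ q.1 (ω q) := by
  simp only [dyadProb]
  rw [Pvec, Hvec_toNet, Zvec_eq_prod, exp_sum, prod_div_distrib]

theorem Emean_eq_sum (F : (Fin n → Fin n → Bool) → ℝ) :
    Emean n m v w g θ F = ∑ ω : {q // q ∈ pairsLT n} → Bool × Bool,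
      (∏ q, dyadProb v w g θ q.1 (ω q)) * F (toNet ω) := by
  rw [Emean, sum_nets]
  exact sum_congr rfl fun ω _ => by rw [Pvec_toNet, mul_comm]

theorem Emean_Hvec (u : Idx m → ℝ) :
    Emean n m v w g θ (Hvec n m v w g u)
      = ∑ q : {q // q ∈ pairsLT n}, wmean (dyadProb v w g θ q.1) (dyadExp v w g u q.1) := by
  rw [Emean_eq_sum]
  simp only [Hvec_toNet]
  exact sum_prod_mul_sum (p := fun q : {q // q ∈ pairsLT n} => dyadProb v w g θ q.1)
    (fun q => sum_dyadProb v w g θ q.1) fun q => dyadExp v w g u q.1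

/-- The quadratic form of the Fisher information is the variance of `uᵀ s(X)`. -/
theorem dotProduct_Ifish_mulVec_eq_sub (u : Idx m → ℝ) :
    u ⬝ᵥ (Ifish n m v w g θ).mulVec u
      = Emean n m v w g θ (fun x => Hvec n m v w g u x ^ 2)
        - Emean n m v w g θ (Hvec n m v w g u) ^ 2 := by
  have h1 : Emean n m v w g θ (fun x => Hvec n m v w g u x ^ 2) = ∑ k, ∑ l, u k * u l *
      Emean n m v w g θ (fun x => svec n m v w g x k * svec n m v w g x l) := by
    simp only [Emean, Hvec, sq, sum_mul_sum]
    simp only [mul_sum, sum_mul]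
    rw [sum_comm]
    refine sum_congr rfl fun k _ => ?_
    rw [sum_comm]
    exact sum_congr rfl fun l _ => sum_congr rfl fun x _ => by ring
  have h2 : Emean n m v w g θ (Hvec n m v w g u)
      = ∑ k, u k * Emean n m v w g θ (fun x => svec n m v w g x k) := by
    simp only [Emean, Hvec, mul_sum, sum_mul]
    rw [sum_comm]
    exact sum_congr rfl fun k _ => sum_congr rfl fun x _ => by ring
  rw [h1, h2, sq, sum_mul_sum]
  simp only [dotProduct, Matrix.mulVec, Ifish, Matrix.of_apply, mul_sum, ← sum_sub_distrib]
  exact sum_congr rfl fun k _ => sum_congr rfl fun l _ => by ring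

theorem dotProduct_Ifish_mulVec_eq_sum (u : Idx m → ℝ) :
    u ⬝ᵥ (Ifish n m v w g θ).mulVec u
      = ∑ q : {q // q ∈ pairsLT n}, wvar (dyadProb v w g θ q.1) (dyadExp v w g u q.1) := by
  rw [dotProduct_Ifish_mulVec_eq_sub, Emean_Hvec, Emean_eq_sum]
  simp only [Hvec_toNet]
  rw [sum_prod_mul_sum_sq (p := fun q : {q // q ∈ pairsLT n} => dyadProb v w g θ q.1)
    (fun q => sum_dyadProb v w g θ q.1) fun q => dyadExp v w g u q.1, add_sub_cancel_left]

theorem dyadExp_add (u : Idx m → ℝ) (q : Fin n × Fin n) (y : Bool × Bool) :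
    dyadExp v w g (θ + u) q y = dyadExp v w g θ q y + dyadExp v w g u q y := by
  simp only [dyadExp, Pi.add_apply, add_mul, sum_add_distrib]

/-- Second-order expansion of the log-partition function with a uniform cubic remainder. -/
theorem abs_log_Zvec_add_sub_le (u : Idx m → ℝ) {b : ℝ} (hb0 : 0 ≤ b) (hb : b ≤ 1 / 4)
    (hu : ∀ q y, |dyadExp v w g u q y| ≤ b) :
    |log (Zvec n m v w g (θ + u)) - log (Zvec n m v w g θ)
        - Emean n m v w g θ (Hvec n m v w g u)
        - u ⬝ᵥ (Ifish n m v w g θ).mulVec u / 2| ≤ Ndyads n * (10 * b ^ 3) := by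
  have hq : ∀ q, log (dyadZ v w g (θ + u) q) - log (dyadZ v w g θ q)
      = log (wmean (dyadProb v w g θ q) fun y => exp (dyadExp v w g u q y)) := fun q => by
    rw [← log_div (dyadZ_pos _ _ _ _ _).ne' (dyadZ_pos _ _ _ _ _).ne']
    congr 1
    simp only [wmean, dyadProb]
    rw [dyadZ, sum_div]
    exact sum_congr rfl fun y _ => by rw [dyadExp_add, exp_add]; ring
  rw [Zvec_eq_prod, Zvec_eq_prod, log_prod fun q _ => (dyadZ_pos _ _ _ _ _).ne',
    log_prod fun q _ => (dyadZ_pos _ _ _ _ _).ne', Emean_Hvec, dotProduct_Ifish_mulVec_eq_sum,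
    sum_div, ← sum_sub_distrib, ← sum_sub_distrib, ← sum_sub_distrib]
  refine (abs_sum_le_sum_abs _ _).trans ?_
  refine (sum_le_card_nsmul _ _ (10 * b ^ 3) fun q _ => ?_).trans_eq ?_
  · rw [hq]
    exact abs_log_wmean_exp_sub_le (dyadProb_nonneg v w g θ q.1) (sum_dyadProb v w g θ q.1)
      hb0 hb (hu q.1)
  · rw [nsmul_eq_mul, card_univ, Fintype.card_coe, card_pairsLT]

theorem abs_Emean_cos_le (u : Idx m → ℝ) (hu : ∀ q y, |dyadExp v w g u q y| ≤ 1) (c : ℝ) :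
    |Emean n m v w g θ fun x => cos (Hvec n m v w g u x - c)|
      ≤ exp (-(u ⬝ᵥ (Ifish n m v w g θ).mulVec u) / 8) := by
  rw [Emean_eq_sum, dotProduct_Ifish_mulVec_eq_sum]
  simp only [Hvec_toNet]
  exact abs_sum_prod_mul_cos_le (p := fun q : {q // q ∈ pairsLT n} => dyadProb v w g θ q.1)
    (f := fun q => dyadExp v w g u q.1) (fun q => dyadProb_nonneg v w g θ q.1)
    (fun q => sum_dyadProb v w g θ q.1) (fun q => hu q.1) c

theorem abs_dyadExp_le {B : ℝ}
    (hB : ∀ (j1 j2 : Fin n) (k : Fin m), |w (v j1 k) (v j2 k)| ≤ B ∧ |g (v j1 k)| ≤ B)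
    (u : Idx m → ℝ) (q : Fin n × Fin n) (y : Bool × Bool) :
    |dyadExp v w g u q y| ≤ Fintype.card (Idx m) * (2 * (|B| + 1)) * ‖u‖ := by
  have hbv : ∀ b : Bool, 0 ≤ bval b ∧ bval b ≤ 1 := fun b => by cases b <;> simp [bval]
  have hpair : ∀ s t : ℝ, |s| ≤ B → |t| ≤ B → |bval y.1 * s + bval y.2 * t| ≤ 2 * (|B| + 1) := by
    intro s t hs ht
    have h1 : |bval y.1 * s| ≤ |s| := by
      rw [abs_mul, abs_of_nonneg (hbv y.1).1]
      exact mul_le_of_le_one_left (abs_nonneg _) (hbv y.1).2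
    have h2 : |bval y.2 * t| ≤ |t| := by
      rw [abs_mul, abs_of_nonneg (hbv y.2).1]
      exact mul_le_of_le_one_left (abs_nonneg _) (hbv y.2).2
    have := abs_add_le (bval y.1 * s) (bval y.2 * t)
    have := le_abs_self B
    linarith
  have hstat : ∀ i, |dyadStat v w g q y i| ≤ 2 * (|B| + 1) := by
    have := abs_nonneg B
    obtain ⟨h1, h1'⟩ := hbv y.1
    obtain ⟨h2, h2'⟩ := hbv y.2
    rintro (i | k | k | k)
    · by_cases hi : i = 0
      · simp only [dyadStat, hi, if_true]
        exact abs_le.2 ⟨by nlinarith, by nlinarith⟩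
      · simp only [dyadStat, hi, if_false]
        exact abs_le.2 ⟨by linarith, by linarith⟩
    · exact hpair _ _ (hB _ _ _).1 (hB _ _ _).1
    · exact hpair _ _ (hB q.1 q.1 k).2 (hB q.2 q.2 k).2
    · exact hpair _ _ (hB q.2 q.2 k).2 (hB q.1 q.1 k).2
  refine (abs_sum_le_sum_abs _ _).trans ?_
  refine (sum_le_card_nsmul _ _ (2 * (|B| + 1) * ‖u‖) fun i _ => ?_).trans_eq ?_
  · rw [abs_mul, mul_comm]
    exact mul_le_mul (hstat i) (norm_le_pi_norm u i) (abs_nonneg _)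
      (by have := abs_nonneg B; linarith)
  · rw [nsmul_eq_mul, card_univ, ← mul_assoc]

theorem Pvec_nonneg (x : Fin n → Fin n → Bool) : 0 ≤ Pvec n m v w g θ x :=
  div_nonneg (exp_pos _).le (Zvec_pos v w g θ).le

theorem sum_Pvec : ∑ x ∈ nets n, Pvec n m v w g θ x = 1 := by
  simp only [Pvec, ← sum_div]
  exact div_self (Zvec_pos v w g θ).ne'

theorem Pr_nonneg (φ : (Fin n → Fin n → Bool) → Prop) : 0 ≤ Pr n m v w g θ φ :=
  sum_nonneg fun x _ => Pvec_nonneg v w g θ x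

theorem Pr_le_Emean {φ : (Fin n → Fin n → Bool) → Prop} {F : (Fin n → Fin n → Bool) → ℝ}
    (hF : ∀ x ∈ nets n, 0 ≤ F x) (h : ∀ x ∈ nets n, φ x → 1 ≤ F x) :
    Pr n m v w g θ φ ≤ Emean n m v w g θ F := by
  rw [Pr, Emean, sum_filter]
  refine sum_le_sum fun x hx => ?_
  split_ifs with hφ
  · exact le_mul_of_one_le_left (Pvec_nonneg v w g θ x) (h x hx hφ)
  · exact mul_nonneg (hF x hx) (Pvec_nonneg v w g θ x)

theorem Pr_le_Pr {φ ψ : (Fin n → Fin n → Bool) → Prop} (h : ∀ x ∈ nets n, φ x → ψ x) :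
    Pr n m v w g θ φ ≤ Pr n m v w g θ ψ :=
  sum_le_sum_of_subset_of_nonneg
    (fun x hx => mem_filter.2 ⟨(mem_filter.1 hx).1, h x (mem_filter.1 hx).1 (mem_filter.1 hx).2⟩)
    fun x _ _ => Pvec_nonneg v w g θ x

theorem Pr_or_le (φ ψ : (Fin n → Fin n → Bool) → Prop) :
    Pr n m v w g θ (fun x => φ x ∨ ψ x) ≤ Pr n m v w g θ φ + Pr n m v w g θ ψ := by
  simp only [Pr, sum_filter, ← sum_add_distrib]
  refine sum_le_sum fun x _ => ?_
  have := Pvec_nonneg v w g θ x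
  by_cases h1 : φ x <;> by_cases h2 : ψ x <;> simp [h1, h2, this]

theorem Pr_exists_le {κ : Type*} (s : Finset κ) (φ : κ → (Fin n → Fin n → Bool) → Prop) :
    Pr n m v w g θ (fun x => ∃ k ∈ s, φ k x) ≤ ∑ k ∈ s, Pr n m v w g θ (φ k) := by
  simp only [Pr, sum_filter]
  rw [sum_comm]
  refine sum_le_sum fun x _ => ?_
  have hnn : ∀ k ∈ s, 0 ≤ if φ k x then Pvec n m v w g θ x else 0 := fun k _ => by
    split_ifs
    exacts [Pvec_nonneg v w g θ x, le_rfl]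
  split_ifs with h
  · obtain ⟨k, hk, hφ⟩ := h
    have := single_le_sum hnn hk
    rwa [if_pos hφ] at this
  · exact sum_nonneg hnn

/-- Chebyshev's inequality for `uᵀ s(X)`. -/
theorem Pr_lt_abs_Hvec_sub_le (u : Idx m → ℝ) {r : ℝ} (hr : 0 < r) :
    Pr n m v w g θ (fun x =>
        r < |Hvec n m v w g u x - Emean n m v w g θ (Hvec n m v w g u)|)
      ≤ u ⬝ᵥ (Ifish n m v w g θ).mulVec u / r ^ 2 := by
  set μ := Emean n m v w g θ (Hvec n m v w g u) with hμ
  have hE : Emean n m v w g θ (fun x => (Hvec n m v w g u x - μ) ^ 2 / r ^ 2)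
      = u ⬝ᵥ (Ifish n m v w g θ).mulVec u / r ^ 2 := by
    have h : Emean n m v w g θ (fun x => (Hvec n m v w g u x - μ) ^ 2 / r ^ 2)
        = (Emean n m v w g θ (fun x => Hvec n m v w g u x ^ 2)
          - 2 * μ * Emean n m v w g θ (Hvec n m v w g u)
          + μ ^ 2 * ∑ x ∈ nets n, Pvec n m v w g θ x) / r ^ 2 := by
      simp only [Emean, mul_sum, ← sum_sub_distrib, ← sum_add_distrib, sum_div]
      exact sum_congr rfl fun x _ => by ring
    rw [h, dotProduct_Ifish_mulVec_eq_sub, sum_Pvec, ← hμ]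
    ring
  rw [← hE]
  refine Pr_le_Emean v w g θ (fun x _ => by positivity) fun x _ hx => ?_
  rw [one_le_div (by positivity), ← sq_abs (Hvec n m v w g u x - μ)]
  exact pow_le_pow_left₀ hr.le hx.le 2

/-- Small-ball probabilities from decay of the cosine moments at the frequencies
`j s`, `1 ≤ j ≤ 2 L`. -/
theorem Pr_abs_sub_le_of_cos (u : Idx m → ℝ) {L : ℕ} (hL : 0 < L) {s c r η : ℝ}
    (hs : 0 ≤ s) (hr : L * s * r ≤ 1)
    (hη : ∀ j : ℕ, 1 ≤ j → j ≤ 2 * L →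
      |Emean n m v w g θ fun x => cos (j * (s * (Hvec n m v w g u x - c)))| ≤ η) :
    Pr n m v w g θ (fun x => |Hvec n m v w g u x - c| ≤ r) ≤ 4 * (1 / L + η) := by
  set W : (Fin n → Fin n → Bool) → ℝ := fun x => s * (Hvec n m v w g u x - c) with hW
  have hL0 : (0 : ℝ) < L := by exact_mod_cast hL
  set F : (Fin n → Fin n → Bool) → ℝ := fun x => 4 * (∑ l ∈ Icc 1 L, cos (l * W x)) ^ 2 / L ^ 2
  have h1 : Pr n m v w g θ (fun x => |Hvec n m v w g u x - c| ≤ r) ≤ Emean n m v w g θ F := by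
    refine Pr_le_Emean v w g θ (fun x _ => by positivity) fun x _ hx => ?_
    have hcos : ∀ l ∈ Icc 1 L, (1 : ℝ) / 2 ≤ cos (l * W x) := fun l hl => by
      have hlL : (l : ℝ) ≤ L := by exact_mod_cast (mem_Icc.1 hl).2
      have habs : |(l : ℝ) * W x| ≤ 1 := by
        rw [hW, abs_mul, abs_mul, abs_of_nonneg hs, Nat.abs_cast]
        calc (l : ℝ) * (s * |Hvec n m v w g u x - c|) ≤ L * (s * r) := by gcongr
          _ ≤ 1 := by rw [← mul_assoc]; exact hr
      have h2 := Real.one_sub_sq_div_two_le_cos (x := l * W x)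
      have h3 : ((l : ℝ) * W x) ^ 2 ≤ 1 := (sq_le_one_iff_abs_le_one _).2 habs
      linarith
    have hsum : (L : ℝ) / 2 ≤ ∑ l ∈ Icc 1 L, cos (l * W x) := by
      have := card_nsmul_le_sum (Icc 1 L) (fun l : ℕ => cos (l * W x)) (1 / 2) hcos
      rw [Nat.card_Icc, nsmul_eq_mul, add_tsub_cancel_right] at this
      linarith
    have h4 : ((L : ℝ) / 2) ^ 2 ≤ (∑ l ∈ Icc 1 L, cos (l * W x)) ^ 2 :=
      pow_le_pow_left₀ (by positivity) hsum 2
    rw [one_le_div (by positivity)]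
    linarith
  have hη0 : 0 ≤ η := (abs_nonneg _).trans (hη 1 le_rfl (by omega))
  have hbound : ∀ j : ℕ, 1 ≤ j → j ≤ 2 * L →
      Emean n m v w g θ (fun x => cos (j * W x)) ≤ η := fun j hj hj' =>
    (le_abs_self _).trans (hη j hj hj')
  have hterm : ∀ l ∈ Icc 1 L, ∀ k ∈ Icc 1 L,
      Emean n m v w g θ (fun x => cos (l * W x) * cos (k * W x))
        ≤ (if l = k then 1 else 0) + η := by
    intro l hl k hk
    obtain ⟨hl1, hl2⟩ := mem_Icc.1 hl
    obtain ⟨hk1, hk2⟩ := mem_Icc.1 hk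
    have key : ∀ d : ℕ, (∀ z : ℝ, cos ((d : ℝ) * z) = cos (l * z - k * z)) →
        Emean n m v w g θ (fun x => cos (l * W x) * cos (k * W x))
          = (Emean n m v w g θ (fun x => cos ((l + k : ℕ) * W x))
            + Emean n m v w g θ (fun x => cos (d * W x))) / 2 := by
      intro d hd
      simp only [Emean, ← sum_add_distrib, sum_div]
      refine sum_congr rfl fun x _ => ?_
      rw [hd, cos_sub]
      push_cast
      rw [add_mul, cos_add]
      ring
    have hlk := hbound (l + k) (by omega) (by omega)
    rcases lt_trichotomy l k with h | h | h
    · have hd := hbound (k - l) (by omega) (by omega)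
      rw [key (k - l) fun z => ?_, if_neg h.ne]
      · linarith
      · rw [Nat.cast_sub h.le, ← cos_neg]
        ring_nf
    · subst h
      have h0 : Emean n m v w g θ (fun x => cos ((0 : ℕ) * W x)) = 1 := by
        simp [Emean, sum_Pvec]
      rw [key 0 fun z => by simp, h0, if_pos rfl]
      linarith
    · have hd := hbound (l - k) (by omega) (by omega)
      rw [key (l - k) fun z => ?_, if_neg h.ne']
      · linarith
      · rw [Nat.cast_sub h.le]
        ring_nf
  have hEF : Emean n m v w g θ F = 4 / L ^ 2 * ∑ l ∈ Icc 1 L, ∑ k ∈ Icc 1 L,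
      Emean n m v w g θ (fun x => cos (l * W x) * cos (k * W x)) := by
    simp only [Emean, F, sq (∑ l ∈ Icc 1 L, _), sum_mul_sum]
    simp only [mul_sum, sum_mul, sum_div]
    rw [sum_comm]
    refine sum_congr rfl fun l _ => ?_
    rw [sum_comm]
    exact sum_congr rfl fun k _ => sum_congr rfl fun x _ => by ring
  refine h1.trans ?_
  rw [hEF]
  calc _ ≤ 4 / (L : ℝ) ^ 2 * ∑ l ∈ Icc 1 L, ∑ k ∈ Icc 1 L, ((if l = k then 1 else 0) + η) := by
        gcongr with l hl k hk
        exact hterm l hl k hk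
    _ = 4 / (L : ℝ) ^ 2 * (L + L * (L * η)) := by
        congr 1
        rw [sum_congr rfl fun l hl => by
          rw [sum_add_distrib, sum_ite_eq, if_pos hl, sum_const, Nat.card_Icc,
            add_tsub_cancel_right, nsmul_eq_mul]]
        rw [sum_const, Nat.card_Icc, add_tsub_cancel_right, nsmul_eq_mul]
        ring
    _ = 4 * (1 / L + η) := by
        field_simp

/-- The log-likelihood is concave. -/
theorem le_Llik_add_smul (x : Fin n → Fin n → Bool) (D : Idx m → ℝ) {τ : ℝ} (h0 : 0 ≤ τ)
    (h1 : τ ≤ 1) :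
    (1 - τ) * Llik n m v w g θ x + τ * Llik n m v w g (θ + D) x
      ≤ Llik n m v w g (θ + τ • D) x := by
  have hH : ∀ y, Hvec n m v w g (θ + τ • D) y
      = (1 - τ) * Hvec n m v w g θ y + τ * Hvec n m v w g (θ + D) y := fun y => by
    simp only [Hvec, mul_sum, ← sum_add_distrib, Pi.add_apply, Pi.smul_apply, smul_eq_mul]
    exact sum_congr rfl fun i _ => by ring
  set a := log (Zvec n m v w g θ) with ha
  set b := log (Zvec n m v w g (θ + D)) with hb
  have hsum : ∀ θ' : Idx m → ℝ,
      ∑ y ∈ nets n, exp (Hvec n m v w g θ' y - log (Zvec n m v w g θ')) = 1 := fun θ' => by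
    simp only [exp_sub, exp_log (Zvec_pos v w g θ'), ← sum_div]
    exact div_self (Zvec_pos v w g θ').ne'
  have hZ : Zvec n m v w g (θ + τ • D) ≤ exp ((1 - τ) * a + τ * b) := by
    have h : ∑ y ∈ nets n, exp (Hvec n m v w g (θ + τ • D) y - ((1 - τ) * a + τ * b)) ≤ 1 := by
      calc _ ≤ ∑ y ∈ nets n, ((1 - τ) * exp (Hvec n m v w g θ y - a)
            + τ * exp (Hvec n m v w g (θ + D) y - b)) := by
            refine sum_le_sum fun y _ => ?_
            have := convexOn_exp.2 (Set.mem_univ (Hvec n m v w g θ y - a))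
              (Set.mem_univ (Hvec n m v w g (θ + D) y - b)) (sub_nonneg.2 h1) h0
              (sub_add_cancel 1 τ)
            simp only [smul_eq_mul] at this
            refine le_trans (le_of_eq ?_) this
            rw [hH]
            congr 1
            ring
        _ = 1 := by
            rw [sum_add_distrib, ← mul_sum, ← mul_sum, hsum, hsum]
            ring
    simp only [exp_sub _ ((1 - τ) * a + τ * b), ← sum_div] at h
    rwa [div_le_one (exp_pos _)] at h
  have hlog : log (Zvec n m v w g (θ + τ • D)) ≤ (1 - τ) * a + τ * b :=
    (log_le_iff_le_exp (Zvec_pos v w g _)).2 hZ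
  simp only [Llik, hH, ← ha, ← hb]
  linarith

end Dyads
section Score

variable {n m : ℕ} (v : Fin n → Fin m → E) (w : E → E → ℝ) (g : E → ℝ) (θ : Idx m → ℝ)

/-- The derivative of the log-likelihood at `θ` in the direction `u`. -/
def score (u : Idx m → ℝ) (x : Fin n → Fin n → Bool) : ℝ :=
  Hvec n m v w g u x - Emean n m v w g θ (Hvec n m v w g u)

/-- The remainder of the log-partition function after its first-order expansion at `θ`. -/
def logZRem (u : Idx m → ℝ) : ℝ :=
  log (Zvec n m v w g (θ + u)) - log (Zvec n m v w g θ) - Emean n m v w g θ (Hvec n m v w g u)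

theorem Hvec_add (u u' : Idx m → ℝ) (x : Fin n → Fin n → Bool) :
    Hvec n m v w g (u + u') x = Hvec n m v w g u x + Hvec n m v w g u' x := by
  simp only [Hvec, Pi.add_apply, add_mul, sum_add_distrib]

theorem Hvec_smul (t : ℝ) (u : Idx m → ℝ) (x : Fin n → Fin n → Bool) :
    Hvec n m v w g (t • u) x = t * Hvec n m v w g u x := by
  simp only [Hvec, Pi.smul_apply, smul_eq_mul, mul_sum, mul_assoc]

theorem Llik_add (u : Idx m → ℝ) (x : Fin n → Fin n → Bool) :
    Llik n m v w g (θ + u) x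
      = Llik n m v w g θ x + score v w g θ u x - logZRem v w g θ u := by
  simp only [Llik, score, logZRem, Hvec_add]
  ring

theorem score_add (u u' : Idx m → ℝ) (x : Fin n → Fin n → Bool) :
    score v w g θ (u + u') x = score v w g θ u x + score v w g θ u' x := by
  have h : Emean n m v w g θ (Hvec n m v w g (u + u'))
      = Emean n m v w g θ (Hvec n m v w g u) + Emean n m v w g θ (Hvec n m v w g u') := by
    simp only [Emean, Hvec_add, add_mul, sum_add_distrib]
  rw [score, h, Hvec_add, score, score]
  ring

theorem score_smul (t : ℝ) (u : Idx m → ℝ) (x : Fin n → Fin n → Bool) :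
    score v w g θ (t • u) x = t * score v w g θ u x := by
  have h : Emean n m v w g θ (Hvec n m v w g (t • u))
      = t * Emean n m v w g θ (Hvec n m v w g u) := by
    simp only [Emean, Hvec_smul, mul_sum, mul_assoc]
  rw [score, h, Hvec_smul, score]
  ring

theorem abs_score_le (u : Idx m → ℝ) (x : Fin n → Fin n → Bool) :
    |score v w g θ u x| ≤ ‖u‖ * ∑ i, |score v w g θ (Pi.single i 1) x| := by
  have hlin : score v w g θ u x = ∑ i, u i * score v w g θ (Pi.single i 1) x := by
    let f : (Idx m → ℝ) →ₗ[ℝ] ℝ :=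
      { toFun := fun u => score v w g θ u x
        map_add' := fun u u' => score_add v w g θ u u' x
        map_smul' := fun t u => score_smul v w g θ t u x }
    change f u = ∑ i, u i * f (Pi.single i 1)
    conv_lhs => rw [pi_eq_sum_univ' u, map_sum]
    refine sum_congr rfl fun i _ => ?_
    rw [map_smul, smul_eq_mul]
  rw [hlin, mul_sum]
  refine (abs_sum_le_sum_abs _ _).trans (sum_le_sum fun i _ => ?_)
  rw [abs_mul]
  exact mul_le_mul_of_nonneg_right (norm_le_pi_norm u i) (abs_nonneg _)

theorem dotProduct_Ifish_mulVec_comm (u u' : Idx m → ℝ) :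
    u ⬝ᵥ (Ifish n m v w g θ).mulVec u' = u' ⬝ᵥ (Ifish n m v w g θ).mulVec u := by
  have h : (Ifish n m v w g θ).transpose = Ifish n m v w g θ := by
    ext k l
    simp only [Matrix.transpose_apply, Ifish, Matrix.of_apply, mul_comm]
  rw [Matrix.dotProduct_mulVec, ← Matrix.mulVec_transpose, h, dotProduct_comm]

end Score

section QuadraticForms

variable {κ : Type*} [Fintype κ]

theorem abs_dotProduct_mulVec_le (A : Matrix κ κ ℝ) (u u' : κ → ℝ) :
    |u ⬝ᵥ A.mulVec u'| ≤ (∑ i, ∑ j, |A i j|) * ‖u‖ * ‖u'‖ := by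
  simp only [dotProduct, Matrix.mulVec, mul_sum, sum_mul]
  refine (abs_sum_le_sum_abs _ _).trans (sum_le_sum fun i _ => ?_)
  refine (abs_sum_le_sum_abs _ _).trans (sum_le_sum fun j _ => ?_)
  rw [abs_mul, abs_mul]
  have h1 : |u i| ≤ ‖u‖ := norm_le_pi_norm u i
  have h2 : |u' j| ≤ ‖u'‖ := norm_le_pi_norm u' j
  calc |u i| * (|A i j| * |u' j|) ≤ ‖u‖ * (|A i j| * ‖u'‖) := by gcongr
    _ = |A i j| * ‖u‖ * ‖u'‖ := by ring

theorem Matrix.PosDef.exists_mul_norm_sq_le [Nonempty κ] {A : Matrix κ κ ℝ} (hA : A.PosDef) :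
    ∃ c > 0, ∀ u : κ → ℝ, c * ‖u‖ ^ 2 ≤ u ⬝ᵥ A.mulVec u := by
  have hpos := (Matrix.posDef_iff_dotProduct_mulVec.1 hA).2
  have hcont : Continuous fun u : κ → ℝ => u ⬝ᵥ A.mulVec u := by fun_prop
  obtain ⟨z, hz, hmin⟩ := (isCompact_sphere (0 : κ → ℝ) 1).exists_isMinOn
    (NormedSpace.sphere_nonempty.2 zero_le_one) hcont.continuousOn
  have hz0 : z ≠ 0 := by
    rintro rfl
    simp at hz
  refine ⟨z ⬝ᵥ A.mulVec z, by simpa using hpos hz0, fun u => ?_⟩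
  rcases eq_or_ne u 0 with rfl | hu
  · simp
  have hn : 0 < ‖u‖ := norm_pos_iff.2 hu
  have h := hmin (show ‖u‖⁻¹ • u ∈ Metric.sphere (0 : κ → ℝ) 1 by
    rw [mem_sphere_zero_iff_norm, norm_smul, norm_inv, norm_norm, inv_mul_cancel₀ hn.ne'])
  simp only [Set.mem_ofPred_eq, Matrix.mulVec_smul, smul_dotProduct, dotProduct_smul,
    smul_eq_mul] at h
  calc z ⬝ᵥ A.mulVec z * ‖u‖ ^ 2
      ≤ ‖u‖⁻¹ * (‖u‖⁻¹ * u ⬝ᵥ A.mulVec u) * ‖u‖ ^ 2 := by gcongr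
    _ = u ⬝ᵥ A.mulVec u := by field_simp

end QuadraticForms

section Asymptotics

open Filter Topology

theorem tendsto_Ndyads : Tendsto Ndyads atTop atTop := by
  refine tendsto_atTop_mono' atTop ?_ (tendsto_sub_atTop_nat 1)
  filter_upwards [eventually_ge_atTop 2] with n hn
  rw [Ndyads, Nat.le_div_iff_mul_le two_pos, mul_comm]
  exact Nat.mul_le_mul_right _ hn

theorem tendsto_sqrt_Ndyads : Tendsto (fun n => √(Ndyads n : ℝ)) atTop atTop :=
  tendsto_sqrt_atTop.comp (tendsto_natCast_atTop_atTop.comp tendsto_Ndyads)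

theorem eventually_log_Ndyads_le {η : ℝ} (hη : 0 < η) :
    ∀ᶠ n in atTop, log (Ndyads n) ≤ η * √(Ndyads n : ℝ) := by
  have h := (isLittleO_log_rpow_atTop (r := 1 / 2) (by norm_num)).bound hη
  filter_upwards [(tendsto_natCast_atTop_atTop.comp tendsto_Ndyads).eventually h] with n hn
  simp only [Function.comp_apply, ← sqrt_eq_rpow, norm_eq_abs] at hn
  rw [abs_of_nonneg (sqrt_nonneg _)] at hn
  exact (le_abs_self _).trans hn

theorem tendsto_zero_of_eventually_le {f : ℕ → ℝ} (h0 : ∀ n, 0 ≤ f n)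
    (h : ∀ ε > 0, ∀ᶠ n in atTop, f n ≤ ε) : Tendsto f atTop (𝓝 0) := by
  refine tendsto_order.2 ⟨fun a ha => .of_forall fun n => ha.trans_le (h0 n), fun a ha => ?_⟩
  filter_upwards [h (a / 2) (half_pos ha)] with n hn
  linarith

variable {m : ℕ} {v : (n : ℕ) → Fin n → Fin m → E} {w : E → E → ℝ} {g : E → ℝ}
  {θ0 : Idx m → ℝ} {Θ : Set (Idx m → ℝ)} {Imat : Matrix (Idx m) (Idx m) ℝ}

theorem CondC1.exists_abs_dyadExp_le (hC1 : CondC1 m v w g θ0 Θ) :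
    ∃ K > 0, ∀ n u q y, |dyadExp (v n) w g u q y| ≤ K * ‖u‖ := by
  obtain ⟨B, hB⟩ := hC1.1
  refine ⟨Fintype.card (Idx m) * (2 * (|B| + 1)), ?_, fun n => abs_dyadExp_le (v n) w g (hB n)⟩
  have : (0 : ℝ) < Fintype.card (Idx m) := by exact_mod_cast Fintype.card_pos
  positivity

theorem CondC2.eventually_abs_sub_le (hC2 : CondC2 m v w g θ0 Imat) {η : ℝ} (hη : 0 < η) :
    ∀ᶠ n in atTop, ∀ u u' : Idx m → ℝ,
      |u ⬝ᵥ (Ifish n m (v n) w g θ0).mulVec u' - Ndyads n * u ⬝ᵥ Imat.mulVec u'|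
        ≤ η * Ndyads n * ‖u‖ * ‖u'‖ := by
  have hlim : Tendsto (fun n => ∑ i, ∑ j,
      |((Ndyads n : ℝ)⁻¹ • Ifish n m (v n) w g θ0 - Imat) i j|) atTop (𝓝 0) := by
    have h0 : ∑ i, ∑ j, |(Imat - Imat) i j| = 0 := by simp
    rw [← h0]
    refine tendsto_finsetSum _ fun i _ => tendsto_finsetSum _ fun j _ => Tendsto.abs ?_
    exact tendsto_pi_nhds.1 (tendsto_pi_nhds.1 (hC2.1.sub_const Imat) i) j
  filter_upwards [hlim.eventually_le_const hη, tendsto_Ndyads.eventually_ge_atTop 1]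
    with n hn hN u u'
  have hN0 : (0 : ℝ) < Ndyads n := by exact_mod_cast hN
  have h := abs_dotProduct_mulVec_le
    ((Ndyads n : ℝ)⁻¹ • Ifish n m (v n) w g θ0 - Imat) u u'
  have heq : u ⬝ᵥ (Ifish n m (v n) w g θ0).mulVec u' - Ndyads n * u ⬝ᵥ Imat.mulVec u'
      = Ndyads n * u ⬝ᵥ ((Ndyads n : ℝ)⁻¹ • Ifish n m (v n) w g θ0 - Imat).mulVec u' := by
    rw [Matrix.sub_mulVec, dotProduct_sub, Matrix.smul_mulVec, dotProduct_smul, smul_eq_mul]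
    field_simp
  rw [heq, abs_mul, abs_of_pos hN0]
  calc _ ≤ (Ndyads n : ℝ) * (η * ‖u‖ * ‖u'‖) := by
        gcongr
        exact h.trans (by gcongr)
    _ = _ := by ring

theorem CondC2.exists_eventually_quadratic (hC2 : CondC2 m v w g θ0 Imat) :
    ∃ c > 0, ∃ C > 0, ∀ᶠ n in atTop, ∀ u : Idx m → ℝ,
      c * Ndyads n * ‖u‖ ^ 2 ≤ u ⬝ᵥ (Ifish n m (v n) w g θ0).mulVec u ∧
      u ⬝ᵥ (Ifish n m (v n) w g θ0).mulVec u ≤ C * Ndyads n * ‖u‖ ^ 2 := by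
  obtain ⟨c, hc, hcu⟩ := hC2.2.exists_mul_norm_sq_le
  have hS : 0 ≤ ∑ i, ∑ j, |Imat i j| := sum_nonneg fun _ _ => sum_nonneg fun _ _ => abs_nonneg _
  refine ⟨c / 2, half_pos hc, (∑ i, ∑ j, |Imat i j|) + c / 2, by positivity, ?_⟩
  filter_upwards [hC2.eventually_abs_sub_le (half_pos hc)] with n hn u
  obtain ⟨h1, h2⟩ := abs_le.1 (hn u u)
  have hN : (0 : ℝ) ≤ Ndyads n := Nat.cast_nonneg _
  have h3 := mul_le_mul_of_nonneg_left (hcu u) hN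
  have h4 := mul_le_mul_of_nonneg_left
    ((le_abs_self _).trans (abs_dotProduct_mulVec_le Imat u u)) hN
  exact ⟨by linarith, by linarith⟩

theorem CondC1.exists_abs_logZRem_sub_le (hC1 : CondC1 m v w g θ0 Θ) :
    ∃ r > 0, ∃ C > 0, ∀ (n : ℕ) (u : Idx m → ℝ), ‖u‖ ≤ r →
      |logZRem (v n) w g θ0 u - u ⬝ᵥ (Ifish n m (v n) w g θ0).mulVec u / 2|
        ≤ C * Ndyads n * ‖u‖ ^ 3 := by
  obtain ⟨K, hK, hKu⟩ := hC1.exists_abs_dyadExp_le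
  refine ⟨1 / (4 * K), by positivity, 10 * K ^ 3, by positivity, fun n u hu => ?_⟩
  rw [le_div_iff₀ (by positivity)] at hu
  refine (abs_log_Zvec_add_sub_le (v n) w g θ0 u (b := K * ‖u‖) (by positivity) (by linarith)
    (hKu n u)).trans_eq ?_
  ring

variable {θMLE : (n : ℕ) → (Fin n → Fin n → Bool) → (Idx m → ℝ)}

/-- Root-`N` consistency of the maximum likelihood estimator. -/
theorem exists_eventually_Pr_lt_norm_le (hC1 : CondC1 m v w g θ0 Θ)
    (hC2 : CondC2 m v w g θ0 Imat)
    (hMLE : ∀ (n : ℕ) (x : Fin n → Fin n → Bool), x ∈ nets n →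
      θMLE n x ∈ Θ ∧ ∀ θ ∈ Θ, Llik n m (v n) w g θ x ≤ Llik n m (v n) w g (θMLE n x) x)
    {ε : ℝ} (hε : 0 < ε) :
    ∃ A > 0, ∀ᶠ n in atTop,
      Pr n m (v n) w g θ0 (fun x => A < √(Ndyads n : ℝ) * ‖θMLE n x - θ0‖) ≤ ε := by
  obtain ⟨c, hc, C, hC, hquad⟩ := hC2.exists_eventually_quadratic
  obtain ⟨r, hr, C', hC', hrem⟩ := hC1.exists_abs_logZRem_sub_le
  set p : ℝ := ((Fintype.card (Idx m) : ℕ) : ℝ) with hp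
  have hp0 : 0 < p := Nat.cast_pos.2 Fintype.card_pos
  set R : ℝ := p * C / ε + 1 with hR
  have hR1 : 1 ≤ R := by rw [hR]; linarith [show 0 < p * C / ε by positivity]
  have hR0 : 0 < R := by linarith
  set A : ℝ := 4 * p * R / c with hA
  have hA0 : 0 < A := by positivity
  have hcA : c * A = 4 * p * R := by rw [hA]; field_simp
  refine ⟨A, hA0, ?_⟩
  filter_upwards [hquad, tendsto_sqrt_Ndyads.eventually_gt_atTop 0,
    tendsto_sqrt_Ndyads.eventually_ge_atTop (A / r),
    tendsto_sqrt_Ndyads.eventually_gt_atTop (C' * A ^ 2 / (p * R))] with n hq hs0 hs1 hs2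
  set s := √(Ndyads n : ℝ) with hs
  have hsN : (Ndyads n : ℝ) = s ^ 2 := (sq_sqrt (Nat.cast_nonneg _)).symm
  rw [hsN] at hq
  replace hrem := hrem n
  rw [hsN] at hrem
  rw [div_le_iff₀ hr] at hs1
  rw [div_lt_iff₀ (by positivity)] at hs2
  have hbad : ∀ x ∈ nets n, A < s * ‖θMLE n x - θ0‖ →
      ∃ i ∈ (univ : Finset (Idx m)), R * s < |score (v n) w g θ0 (Pi.single i 1) x| := by
    intro x hx hlt
    by_contra! hgood
    set D := θMLE n x - θ0 with hD
    have hDs : 0 < s * ‖D‖ := hA0.trans hlt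
    set τ := A / (s * ‖D‖) with hτ
    have hτ0 : 0 ≤ τ := by positivity
    have hτ1 : τ ≤ 1 := (div_le_one hDs).2 hlt.le
    have hu : ‖τ • D‖ = A / s := by
      have hD0 : ‖D‖ ≠ 0 := fun h => by simp [h] at hDs
      rw [norm_smul, norm_eq_abs, abs_of_nonneg hτ0, hτ]
      field_simp
    have hconc := le_Llik_add_smul (v n) w g θ0 x D hτ0 hτ1
    rw [hD, add_sub_cancel, ← hD] at hconc
    have hmax := (hMLE n x hx).2 θ0 (interior_subset hC1.2.2.2)
    rw [Llik_add] at hconc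
    have h1 : 0 ≤ score (v n) w g θ0 (τ • D) x - logZRem (v n) w g θ0 (τ • D) := by
      have := mul_le_mul_of_nonneg_left hmax hτ0
      linarith
    have h2 : score (v n) w g θ0 (τ • D) x ≤ A * (p * R) := by
      refine (le_abs_self _).trans ((abs_score_le _ _ _ _ _ _).trans ?_)
      have h3 : ∑ i, |score (v n) w g θ0 (Pi.single i 1) x| ≤ p * (R * s) := by
        refine (sum_le_card_nsmul _ _ (R * s) hgood).trans_eq ?_
        rw [nsmul_eq_mul, card_univ]
      rw [hu]
      calc A / s * ∑ i, |score (v n) w g θ0 (Pi.single i 1) x| ≤ A / s * (p * (R * s)) := by gcongr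
        _ = A * (p * R) := by field_simp
    have h4 := abs_le.1 (hrem (τ • D) (by rw [hu, div_le_iff₀ hs0, mul_comm]; exact hs1))
    have h5 := (hq (τ • D)).1
    rw [hu] at h4 h5
    have h6 : c * s ^ 2 * (A / s) ^ 2 = 4 * (A * (p * R)) := by
      have : c * s ^ 2 * (A / s) ^ 2 = c * A * A := by field_simp
      rw [this, hcA]
      ring
    have h7 : C' * s ^ 2 * (A / s) ^ 3 < A * (p * R) := by
      have : C' * s ^ 2 * (A / s) ^ 3 = A * (C' * A ^ 2) / s := by field_simp
      rw [this, div_lt_iff₀ hs0, mul_assoc]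
      exact mul_lt_mul_of_pos_left (by linarith) hA0
    linarith
  refine (Pr_le_Pr _ _ _ _ hbad).trans ((Pr_exists_le _ _ _ _ _ _).trans ?_)
  refine (sum_le_card_nsmul _ _ (C / R ^ 2) fun i _ => ?_).trans ?_
  · refine (Pr_lt_abs_Hvec_sub_le (v n) w g θ0 (Pi.single i 1) (mul_pos hR0 hs0)).trans ?_
    have h8 := (hq (Pi.single i 1)).2
    have h9 : ‖(Pi.single i 1 : Idx m → ℝ)‖ = 1 := by
      rw [Pi.norm_single, norm_one]
    rw [h9] at h8
    rw [div_le_div_iff₀ (by positivity) (by positivity)]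
    calc _ ≤ C * s ^ 2 * 1 ^ 2 * R ^ 2 := by gcongr
      _ = C * (R * s) ^ 2 := by ring
  · rw [nsmul_eq_mul, card_univ, ← hp, ← mul_div_assoc, div_le_iff₀ (by positivity)]
    have h10 : p * C = ε * (R - 1) := by rw [hR]; field_simp; ring
    rw [h10]
    gcongr
    nlinarith

/-- The score in a fixed direction puts little mass near zero on the scale `√N`. -/
theorem exists_eventually_Pr_abs_score_le (hC1 : CondC1 m v w g θ0 Θ)
    (hC2 : CondC2 m v w g θ0 Imat) {a : Idx m → ℝ} (ha : a ≠ 0) {ε : ℝ} (hε : 0 < ε) :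
    ∃ ρ > 0, ∀ᶠ n in atTop,
      Pr n m (v n) w g θ0 (fun x => |score (v n) w g θ0 a x| ≤ ρ * √(Ndyads n : ℝ)) ≤ ε := by
  obtain ⟨c, hc, C, hC, hquad⟩ := hC2.exists_eventually_quadratic
  obtain ⟨K, hK, hKu⟩ := hC1.exists_abs_dyadExp_le
  have ha0 : 0 < ‖a‖ := norm_pos_iff.2 ha
  obtain ⟨L, hL⟩ := exists_nat_gt (8 / ε)
  have hL0 : (0 : ℝ) < L := (by positivity : (0 : ℝ) < 8 / ε).trans hL
  obtain ⟨S, hS0, hS⟩ : ∃ S : ℝ, 0 < S ∧ exp (-(c * S ^ 2 * ‖a‖ ^ 2) / 8) ≤ ε / 8 := by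
    have h : Tendsto (fun S : ℝ => exp (-(c * S ^ 2 * ‖a‖ ^ 2) / 8)) atTop (𝓝 0) := by
      refine tendsto_exp_atBot.comp ?_
      have : Tendsto (fun S : ℝ => (c * ‖a‖ ^ 2 / 8) * S ^ 2) atTop atTop :=
        (tendsto_pow_atTop two_ne_zero).const_mul_atTop (by positivity)
      refine (tendsto_neg_atTop_atBot.comp this).congr fun S => ?_
      simp only [Function.comp_apply]
      ring
    obtain ⟨S, h1, h2⟩ := ((eventually_gt_atTop 0).and
      (h.eventually_le_const (by positivity : 0 < ε / 8))).exists
    exact ⟨S, h1, h2⟩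
  refine ⟨1 / (L * S), by positivity, ?_⟩
  filter_upwards [hquad, tendsto_sqrt_Ndyads.eventually_gt_atTop 0,
    tendsto_sqrt_Ndyads.eventually_ge_atTop (K * (2 * L * S * ‖a‖))] with n hq hs0 hs1
  set s := √(Ndyads n : ℝ) with hs
  have hsN : (Ndyads n : ℝ) = s ^ 2 := (sq_sqrt (Nat.cast_nonneg _)).symm
  have hqa := (hq a).1
  rw [hsN] at hqa
  refine (Pr_abs_sub_le_of_cos (v n) w g θ0 a (L := L) (by exact_mod_cast hL0) (s := S / s)
    (η := ε / 8) (by positivity) (le_of_eq (by field_simp)) fun j hj hj' => ?_).trans ?_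
  · have hj1 : (1 : ℝ) ≤ j := by exact_mod_cast hj
    have hjL : (j : ℝ) ≤ 2 * L := by exact_mod_cast hj'
    set t : ℝ := j * (S / s) with ht
    have ht0 : 0 < t := by positivity
    have hfun : (fun x => cos (j * (S / s * (Hvec n m (v n) w g a x
          - Emean n m (v n) w g θ0 (Hvec n m (v n) w g a)))))
        = fun x => cos (Hvec n m (v n) w g (t • a) x
          - t * Emean n m (v n) w g θ0 (Hvec n m (v n) w g a)) := by
      funext x
      rw [Hvec_smul, ht]
      congr 1
      ring
    rw [hfun]
    refine (abs_Emean_cos_le (v n) w g θ0 (t • a) (fun q y => ?_) _).trans (le_trans ?_ hS)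
    · refine (hKu n _ q y).trans ?_
      rw [norm_smul, norm_eq_abs, abs_of_pos ht0]
      calc K * (t * ‖a‖) = K * (j * S * ‖a‖) / s := by rw [ht]; ring
        _ ≤ K * (2 * L * S * ‖a‖) / s := by gcongr
        _ ≤ 1 := (div_le_one hs0).2 hs1
    · rw [exp_le_exp, Matrix.mulVec_smul, smul_dotProduct, dotProduct_smul, smul_eq_mul,
        smul_eq_mul]
      have h1 : c * S ^ 2 * ‖a‖ ^ 2 ≤ t * (t * a ⬝ᵥ (Ifish n m (v n) w g θ0).mulVec a) := by
        calc c * S ^ 2 * ‖a‖ ^ 2 = 1 ^ 2 * (c * S ^ 2 * ‖a‖ ^ 2) := by ring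
          _ ≤ (j : ℝ) ^ 2 * (c * S ^ 2 * ‖a‖ ^ 2) := by gcongr
          _ = t * (t * (c * s ^ 2 * ‖a‖ ^ 2)) := by rw [ht]; field_simp
          _ ≤ _ := by gcongr
      linarith
  · rw [div_lt_iff₀ hε] at hL
    have : 1 / (L : ℝ) ≤ ε / 8 := by
      rw [div_le_div_iff₀ hL0 (by norm_num)]
      linarith
    linarith

/-- A coordinate of the maximum likelihood estimator is exactly equal to the true value with
vanishing probability. -/
theorem eventually_Pr_apply_eq_le (hC1 : CondC1 m v w g θ0 Θ)
    (hC2 : CondC2 m v w g θ0 Imat)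
    (hMLE : ∀ (n : ℕ) (x : Fin n → Fin n → Bool), x ∈ nets n →
      θMLE n x ∈ Θ ∧ ∀ θ ∈ Θ, Llik n m (v n) w g θ x ≤ Llik n m (v n) w g (θMLE n x) x)
    (k : Idx m) {ε : ℝ} (hε : 0 < ε) :
    ∀ᶠ n in atTop, Pr n m (v n) w g θ0 (fun x => θMLE n x k = θ0 k) ≤ ε := by
  obtain ⟨a, haI⟩ : ∃ a, Imat.mulVec a = Pi.single k 1 := by
    refine ⟨Imat⁻¹.mulVec (Pi.single k 1), ?_⟩
    rw [Matrix.mulVec_mulVec, Matrix.mul_nonsing_inv _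
      ((Matrix.isUnit_iff_isUnit_det _).1 hC2.2.isUnit), Matrix.one_mulVec]
  have ha : a ≠ 0 := by
    rintro rfl
    have := congrFun haI k
    simp at this
  set α := ‖a‖ with hα
  have hα0 : 0 < α := norm_pos_iff.2 ha
  obtain ⟨_, -, C, hC, hquad⟩ := hC2.exists_eventually_quadratic
  obtain ⟨r, hr, C', hC', hrem⟩ := hC1.exists_abs_logZRem_sub_le
  obtain ⟨A, hA, hcons⟩ := exists_eventually_Pr_lt_norm_le hC1 hC2 hMLE (half_pos hε)
  obtain ⟨ρ, hρ, hball⟩ := exists_eventually_Pr_abs_score_le hC1 hC2 ha (half_pos hε)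
  obtain ⟨r', hr', hΘ⟩ := Metric.isOpen_iff.1 isOpen_interior θ0 hC1.2.2.2
  set t : ℝ := ρ / (2 * C * α ^ 2) with ht
  have ht0 : 0 < t := by positivity
  have hη : 0 < ρ / (4 * A * α) := by positivity
  filter_upwards [hquad, hcons, hball, hC2.eventually_abs_sub_le hη,
    tendsto_sqrt_Ndyads.eventually_gt_atTop 0,
    tendsto_sqrt_Ndyads.eventually_ge_atTop ((A + t * α) / r),
    tendsto_sqrt_Ndyads.eventually_gt_atTop ((A + t * α) / r'),
    tendsto_sqrt_Ndyads.eventually_ge_atTop (2 * C' * (A + t * α) ^ 3 / (t * ρ / 4))]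
    with n hq hcons hball hlin hs0 hs1 hs2 hs3
  set s := √(Ndyads n : ℝ) with hs
  have hsN : (Ndyads n : ℝ) = s ^ 2 := (sq_sqrt (Nat.cast_nonneg _)).symm
  replace hrem := hrem n
  rw [hsN] at hq hrem hlin
  rw [div_le_iff₀ hr] at hs1
  rw [div_lt_iff₀ hr'] at hs2
  rw [div_le_iff₀ (by positivity)] at hs3
  have hsub : ∀ x ∈ nets n, θMLE n x k = θ0 k →
      A < s * ‖θMLE n x - θ0‖ ∨ |score (v n) w g θ0 a x| ≤ ρ * s := by
    intro x hx hk
    by_contra! hcon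
    obtain ⟨hD, hsc⟩ := hcon
    set D := θMLE n x - θ0 with hDdef
    have hDk : D k = 0 := by simp [hDdef, hk]
    have hDn : ‖D‖ ≤ A / s := by rw [le_div_iff₀ hs0, mul_comm]; exact hD
    have hrr : (A + t * α) / s ≤ r := by rw [div_le_iff₀ hs0]; linarith
    have hbound : ∀ σ : ℝ, |σ| = 1 → σ * score (v n) w g θ0 a x ≤ ρ * s := by
      intro σ hσ
      set δ : Idx m → ℝ := (σ * (t / s)) • a with hδ
      have hδn : ‖δ‖ = t * α / s := by
        rw [hδ, norm_smul, norm_eq_abs, abs_mul, hσ, abs_of_pos (by positivity : 0 < t / s)]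
        ring
      have hDδ : ‖D + δ‖ ≤ (A + t * α) / s := by
        rw [add_div, ← hδn]
        exact (norm_add_le _ _).trans (by gcongr)
      have hmem : θ0 + (D + δ) ∈ Θ := by
        refine interior_subset (hΘ ?_)
        rw [mem_ball_iff_norm, add_sub_cancel_left]
        refine hDδ.trans_lt ?_
        rw [div_lt_iff₀ hs0]
        linarith
      have hmax := (hMLE n x hx).2 _ hmem
      rw [← add_sub_cancel θ0 (θMLE n x), ← hDdef, Llik_add, Llik_add, score_add] at hmax
      have hcube : ∀ u : Idx m → ℝ, ‖u‖ ≤ (A + t * α) / s →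
          C' * s ^ 2 * ‖u‖ ^ 3 ≤ t * ρ / 8 := fun u hu => by
        calc C' * s ^ 2 * ‖u‖ ^ 3 ≤ C' * s ^ 2 * ((A + t * α) / s) ^ 3 := by gcongr
          _ = C' * (A + t * α) ^ 3 / s := by field_simp
          _ ≤ t * ρ / 8 := by
            rw [div_le_iff₀ hs0]
            linarith
      have hDn' : ‖D‖ ≤ (A + t * α) / s := hDn.trans (by gcongr; linarith [mul_pos ht0 hα0])
      have h1 := abs_le.1 ((hrem _ (hDδ.trans hrr)).trans (hcube _ hDδ))
      have h2 := abs_le.1 ((hrem _ (hDn'.trans hrr)).trans (hcube _ hDn'))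
      have hexp : (D + δ) ⬝ᵥ (Ifish n m (v n) w g θ0).mulVec (D + δ)
          = D ⬝ᵥ (Ifish n m (v n) w g θ0).mulVec D
            + 2 * D ⬝ᵥ (Ifish n m (v n) w g θ0).mulVec δ
            + δ ⬝ᵥ (Ifish n m (v n) w g θ0).mulVec δ := by
        rw [Matrix.mulVec_add, add_dotProduct, dotProduct_add, dotProduct_add,
          dotProduct_Ifish_mulVec_comm _ _ _ _ δ D]
        ring
      have hcross : D ⬝ᵥ (Ifish n m (v n) w g θ0).mulVec δ ≤ t * ρ / 4 := by
        have h3 : D ⬝ᵥ Imat.mulVec δ = 0 := by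
          rw [hδ, Matrix.mulVec_smul, haI, dotProduct_smul, dotProduct_single, hDk]
          simp
        have h4 := (le_abs_self _).trans (hlin D δ)
        rw [h3, mul_zero, sub_zero, hδn] at h4
        refine h4.trans ?_
        calc ρ / (4 * A * α) * s ^ 2 * ‖D‖ * (t * α / s)
            ≤ ρ / (4 * A * α) * s ^ 2 * (A / s) * (t * α / s) := by gcongr
          _ = t * ρ / 4 := by field_simp
      have hδδ : δ ⬝ᵥ (Ifish n m (v n) w g θ0).mulVec δ ≤ t * ρ / 2 := by
        refine (hq δ).2.trans_eq ?_
        rw [hδn]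
        have : t * (2 * C * α ^ 2) = ρ := by rw [ht]; field_simp
        calc C * s ^ 2 * (t * α / s) ^ 2 = t * (t * (2 * C * α ^ 2)) / 2 := by field_simp
          _ = t * ρ / 2 := by rw [this]
      have hscore : score (v n) w g θ0 δ x = t / s * (σ * score (v n) w g θ0 a x) := by
        rw [hδ, score_smul]
        ring
      have h5 : t / s * (σ * score (v n) w g θ0 a x) ≤ t * ρ := by
        rw [← hscore]
        have := mul_pos ht0 hρ
        linarith
      rw [div_mul_eq_mul_div, div_le_iff₀ hs0, mul_assoc] at h5
      exact le_of_mul_le_mul_left h5 ht0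
    have h6 := hbound 1 (by simp)
    have h7 := hbound (-1) (by simp)
    exact hsc.not_ge (abs_le.2 ⟨by linarith, by linarith⟩)
  refine (Pr_le_Pr (v n) w g θ0 hsub).trans ((Pr_or_le (v n) w g θ0 _ _).trans ?_)
  linarith

end Asymptotics

/-- Under conditions (C1) and (C2), if the weights are the adaptive
weights `w_k = 1/|θ̂_{MLE,k}|` built from the maximum likelihood estimator, and
`λ_N ≍ log N`, then the two rate conditions of Theorem 2 hold:
`a_w/√N = λ_N max_{k∈A} w_k / √N → 0` in probability and
`b_w/√N = λ_N min_{k∉A} w_k / √N → ∞` in probability. -/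
theorem adaptive_weights_rate_conditions {E : Type*} (m : ℕ) (hm : 1 ≤ m)
    (v : (n : ℕ) → Fin n → Fin m → E) (w : E → E → ℝ) (g : E → ℝ)
    (hw : ∀ u u' : E, w u u' = w u' u)
    (θ0 : Idx m → ℝ) (Θ : Set (Idx m → ℝ)) (Imat : Matrix (Idx m) (Idx m) ℝ)
    (hC1 : CondC1 m v w g θ0 Θ) (hC2 : CondC2 m v w g θ0 Imat)
    (hA : ((Finset.univ : Finset (Idx m)).filter fun k => θ0 k ≠ 0).Nonempty)
    (hAc : ((Finset.univ : Finset (Idx m)).filter fun k => θ0 k = 0).Nonempty)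
    (θMLE : (n : ℕ) → (Fin n → Fin n → Bool) → (Idx m → ℝ))
    (hMLE : ∀ (n : ℕ) (x : Fin n → Fin n → Bool), x ∈ nets n →
      θMLE n x ∈ Θ ∧ ∀ θ ∈ Θ, Llik n m (v n) w g θ x ≤ Llik n m (v n) w g (θMLE n x) x)
    (lam : ℕ → ℝ)
    (hlam : ∃ c1 c2 : ℝ, 0 < c1 ∧ c1 ≤ c2 ∧
      ∀ᶠ n : ℕ in Filter.atTop,
        c1 * Real.log (Ndyads n) ≤ lam n ∧ lam n ≤ c2 * Real.log (Ndyads n)) :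
    -- `a_w/√N → 0` in probability, with `a_w = λ_N max_{k ∈ A} 1/|θ̂_{MLE,k}|`
    (∀ ε > (0 : ℝ),
      Filter.Tendsto
        (fun n : ℕ => Pr n m (v n) w g θ0
          (fun x => ε < lam n
            * (((Finset.univ : Finset (Idx m)).filter fun k => θ0 k ≠ 0).sup' hA
                (fun k => |θMLE n x k|⁻¹))
            / Real.sqrt (Ndyads n)))
        Filter.atTop (nhds 0))
    -- `b_w/√N → ∞` in probability, with `b_w = λ_N min_{k ∉ A} 1/|θ̂_{MLE,k}|`
    ∧ (∀ M : ℝ,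
      Filter.Tendsto
        (fun n : ℕ => Pr n m (v n) w g θ0
          (fun x => lam n
            * (((Finset.univ : Finset (Idx m)).filter fun k => θ0 k = 0).inf' hAc
                (fun k => |θMLE n x k|⁻¹))
            / Real.sqrt (Ndyads n) ≤ M))
        Filter.atTop (nhds 0)) := by
  obtain ⟨c1, c2, hc1, hc12, hlam⟩ := hlam
  have hc2 : 0 < c2 := hc1.trans_le hc12
  have hlogN : Filter.Tendsto (fun n => log (Ndyads n)) Filter.atTop Filter.atTop :=
    tendsto_log_atTop.comp (tendsto_natCast_atTop_atTop.comp tendsto_Ndyads)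
  refine ⟨fun ε hε => ?_, fun M => ?_⟩
  · refine tendsto_zero_of_eventually_le (fun n => Pr_nonneg _ _ _ _ _) fun ε' hε' => ?_
    obtain ⟨A, hA0, hcons⟩ := exists_eventually_Pr_lt_norm_le hC1 hC2 hMLE hε'
    obtain ⟨β, hβ0, hβ⟩ : ∃ β > 0, ∀ k, θ0 k ≠ 0 → β ≤ |θ0 k| := by
      obtain ⟨k, hk, hmin⟩ := exists_min_image _ (fun k => |θ0 k|) hA
      exact ⟨|θ0 k|, abs_pos.2 (mem_filter.1 hk).2, fun l hl => hmin l (by simp [hl])⟩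
    filter_upwards [hcons, hlam, hlogN.eventually_ge_atTop 0,
      eventually_log_Ndyads_le (by positivity : 0 < ε * β / (2 * c2)),
      tendsto_sqrt_Ndyads.eventually_gt_atTop 0,
      tendsto_sqrt_Ndyads.eventually_ge_atTop (A / (β / 2))] with n hn hl hlog hlog' hs0 hs1
    refine (Pr_le_Pr _ _ _ _ fun x _ hev => ?_).trans hn
    by_contra! hle
    refine hev.not_ge ?_
    rw [div_le_iff₀ (by positivity)] at hs1
    have hsup : ((Finset.univ : Finset (Idx m)).filter fun k => θ0 k ≠ 0).sup' hA
        (fun k => |θMLE n x k|⁻¹) ≤ 2 / β := by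
      refine sup'_le _ _ fun k hk => ?_
      have h1 : |θMLE n x k - θ0 k| ≤ ‖θMLE n x - θ0‖ := norm_le_pi_norm (θMLE n x - θ0) k
      have h2 : ‖θMLE n x - θ0‖ ≤ β / 2 := le_of_mul_le_mul_left (hle.trans hs1) hs0
      have h3 := hβ k (mem_filter.1 hk).2
      have h4 := abs_sub_abs_le_abs_sub (θ0 k) (θMLE n x k)
      rw [abs_sub_comm] at h4
      rw [← inv_div]
      exact inv_anti₀ (by positivity) (by linarith)
    have hlam0 : 0 ≤ lam n := (mul_nonneg hc1.le hlog).trans hl.1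
    rw [div_le_iff₀ hs0]
    calc _ ≤ lam n * (2 / β) := by gcongr
      _ ≤ c2 * (ε * β / (2 * c2) * √(Ndyads n : ℝ)) * (2 / β) := by
        gcongr
        exact hl.2.trans (by gcongr)
      _ = ε * √(Ndyads n : ℝ) := by field_simp
  · refine tendsto_zero_of_eventually_le (fun n => Pr_nonneg _ _ _ _ _) fun ε' hε' => ?_
    obtain ⟨A, hA0, hcons⟩ := exists_eventually_Pr_lt_norm_le hC1 hC2 hMLE (half_pos hε')
    set s := (Finset.univ : Finset (Idx m)).filter fun k => θ0 k = 0
    have hcard : (0 : ℝ) < s.card := by exact_mod_cast hAc.card_pos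
    have hzero : ∀ᶠ n in Filter.atTop, ∀ k ∈ s,
        Pr n m (v n) w g θ0 (fun x => θMLE n x k = θ0 k) ≤ ε' / 2 / s.card :=
      (Filter.eventually_all_finset s).2 fun k _ =>
        eventually_Pr_apply_eq_le hC1 hC2 hMLE k (by positivity)
    filter_upwards [hcons, hzero, hlam, hlogN.eventually_gt_atTop (A * |M| / c1),
      tendsto_sqrt_Ndyads.eventually_gt_atTop 0] with n hn hz hl hlog hs0
    rw [div_lt_iff₀ hc1] at hlog
    have hlamA : A * |M| < lam n := by linarith [hl.1]
    have hlam0 : 0 < lam n := (by positivity : 0 ≤ A * |M|).trans_lt hlamA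
    have hsub : ∀ x ∈ nets n, lam n * s.inf' hAc (fun k => |θMLE n x k|⁻¹) / √(Ndyads n : ℝ) ≤ M →
        A < √(Ndyads n : ℝ) * ‖θMLE n x - θ0‖ ∨ ∃ k ∈ s, θMLE n x k = θ0 k := by
      intro x _ hev
      by_contra! hcon
      obtain ⟨hD, hne⟩ := hcon
      obtain ⟨k, hk, hinf⟩ := exists_mem_eq_inf' hAc fun k => |θMLE n x k|⁻¹
      have hk0 : θ0 k = 0 := (mem_filter.1 hk).2
      have hpos : 0 < |θMLE n x k| := abs_pos.2 (by rw [← hk0]; exact hne k hk)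
      have h1 : |θMLE n x k - θ0 k| ≤ ‖θMLE n x - θ0‖ := norm_le_pi_norm (θMLE n x - θ0) k
      rw [hk0, sub_zero] at h1
      have h2 : √(Ndyads n : ℝ) * |θMLE n x k| ≤ A := (by gcongr : _ ≤ _).trans hD
      rw [hinf, ← div_eq_mul_inv, div_div, mul_comm |_|, div_le_iff₀ (by positivity)] at hev
      have h3 : M * (√(Ndyads n : ℝ) * |θMLE n x k|) ≤ |M| * A := by
        have := le_abs_self M
        gcongr
      linarith
    refine (Pr_le_Pr _ _ _ _ hsub).trans ((Pr_or_le _ _ _ _ _ _).trans ?_)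
    have h4 := (Pr_exists_le (v n) w g θ0 s fun k x => θMLE n x k = θ0 k).trans
      (sum_le_card_nsmul _ _ _ hz)
    rw [nsmul_eq_mul, mul_div_cancel₀ _ hcard.ne'] at h4
    linarith
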